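/- arXiv:1909.09371 — 13 statements merged into one kernel-verified Lean document; each statement's English description precedes it below -/
import Mathlib

section
/- Let G = (V,E) be a double-threshold graph defined by w : V → ℝ and lb, ub ∈ ℝ. For every pair of real numbers lb*, ub* with lb* < ub*, there exists a weight function w* : V → ℝ such that w*, lb*, ub* define G and moreover: (1) {v ∈ V : lb/2 ≤ w(v) ≤ ub/2} = {v ∈ V : lb*/2 ≤ w*(v) ≤ ub*/2}; (2) w*(u) + w*(v) ∉ {lb*, ub*} for all (not necessarily distinct) u, v ∈ V; and (3) w* is injective, i.e., w*(u) ≠ w*(v) whenever u ≠ v. -/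
def DefinesDTG {V : Type*} (G : SimpleGraph V) (w : V → ℝ) (lb ub : ℝ) : Prop :=
  ∀ u v : V, u ≠ v → (G.Adj u v ↔ lb ≤ w u + w v ∧ w u + w v ≤ ub)

open Filter Topology in
/-- A positive real below all the positive members of a finite family. -/
theorem exists_pos_forall_lt_of_pos {ι : Type*} [Finite ι] (d : ι → ℝ) :
    ∃ t : ℝ, 0 < t ∧ ∀ i, 0 < d i → t < d i := by
  have h : ∀ᶠ t : ℝ in 𝓝[>] 0, ∀ i, 0 < d i → t < d i := by
    rw [eventually_all]
    intro i
    by_cases hi : 0 < d i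
    · filter_upwards [Ioo_mem_nhdsGT hi] with t ht _
      exact ht.2
    · exact Eventually.of_forall fun t h => absurd h hi
  obtain ⟨t, ht, ht0⟩ := (h.and self_mem_nhdsWithin).exists
  exact ⟨t, ht0, ht⟩

theorem exists_injective_pos_lt_half (V : Type*) [Finite V] :
    ∃ f : V → ℝ, Function.Injective f ∧ ∀ v, 0 < f v ∧ f v < 1 / 2 := by
  obtain ⟨n, ⟨e⟩⟩ := Finite.exists_equiv_fin V
  refine ⟨fun v => 1 / (((e v : ℕ) : ℝ) + 3), fun u v h => ?_, fun v => ⟨by positivity, ?_⟩⟩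
  · have h' : ((e u : ℕ) : ℝ) = (e v : ℕ) := by simpa using h
    exact e.injective (Fin.ext (by exact_mod_cast h'))
  · apply one_div_lt_one_div_of_lt two_pos
    have : (0 : ℝ) ≤ ((e v : ℕ) : ℝ) := Nat.cast_nonneg _
    linarith

/-- It suffices to preserve, over all pairs of not necessarily distinct vertices, the condition
that the sum of the weights lies between the thresholds. -/
theorem exists_injective_weight_sum_mem_iff {V : Type*} [Finite V] (w : V → ℝ) (lb ub : ℝ)
    (lbs ubs : ℝ) (hlt : lbs < ubs) :
    ∃ ws : V → ℝ, (∀ u v, (lb ≤ w u + w v ∧ w u + w v ≤ ub) ↔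
        (lbs ≤ ws u + ws v ∧ ws u + ws v ≤ ubs)) ∧
      (∀ u v, ws u + ws v ≠ lbs ∧ ws u + ws v ≠ ubs) ∧ Function.Injective ws := by
  obtain ⟨f, hf, hf'⟩ := exists_injective_pos_lt_half V
  rcases lt_or_ge ub lb with hlu | hlu
  · refine ⟨fun v => ubs / 2 + f v, fun u v => ?_, fun u v => ?_, fun u v h => hf ?_⟩
    · have := hf' u
      have := hf' v
      constructor <;> rintro ⟨_, _⟩ <;> exfalso <;> linarith
    · have := hf' u
      have := hf' v
      constructor <;> apply ne_of_gt <;> linarith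
    · simpa using h
  obtain ⟨t₁, ht₁, h₁⟩ := exists_pos_forall_lt_of_pos fun p : V × V => lb - (w p.1 + w p.2)
  obtain ⟨t₂, ht₂, h₂⟩ := exists_pos_forall_lt_of_pos fun p : V × V => w p.1 + w p.2 - ub
  obtain ⟨t₃, ht₃, h₃⟩ := exists_pos_forall_lt_of_pos fun p : V × V => w p.1 - w p.2
  obtain ⟨t, ht, htl₁, htl₂, htl₃⟩ : ∃ t : ℝ, 0 < t ∧ 2 * t ≤ t₁ ∧ t ≤ t₂ ∧ t ≤ t₃ := by
    refine ⟨min (t₁ / 2) (min t₂ t₃), by positivity, ?_, ?_, ?_⟩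
    · linarith [min_le_left (t₁ / 2) (min t₂ t₃)]
    · exact (min_le_right _ _).trans (min_le_left _ _)
    · exact (min_le_right _ _).trans (min_le_right _ _)
  have hD : 0 < ub - lb + 2 * t := by linarith
  obtain ⟨a, ha, haD⟩ : ∃ a : ℝ, 0 < a ∧ a * (ub - lb + 2 * t) = ubs - lbs :=
    ⟨(ubs - lbs) / (ub - lb + 2 * t), div_pos (by linarith) hD, div_mul_cancel₀ _ hD.ne'⟩
  have hft : ∀ v, 0 < t * f v ∧ t * f v < t / 2 := fun v =>
    ⟨mul_pos ht (hf' v).1, by nlinarith [(hf' v).2]⟩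
  have hpos : ∀ x, 0 < x → 0 < a * x := fun x => mul_pos ha
  have key : ∀ u v,
      (lb ≤ w u + w v → 0 < w u + t * f u + (w v + t * f v) - (lb - t)) ∧
      (w u + w v < lb → 0 < (lb - t) - (w u + t * f u + (w v + t * f v))) ∧
      (w u + w v ≤ ub → 0 < (ub + t) - (w u + t * f u + (w v + t * f v))) ∧
      (ub < w u + w v → 0 < w u + t * f u + (w v + t * f v) - (ub + t)) := by
    intro u v
    have := hft u
    have := hft v
    have h₁' := h₁ (u, v)
    have h₂' := h₂ (u, v)
    simp only [sub_pos] at h₁' h₂'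
    refine ⟨fun h => ?_, fun h => ?_, fun h => ?_, fun h => ?_⟩
    · linarith
    · linarith [h₁' h]
    · linarith
    · linarith [h₂' h]
  set ws : V → ℝ := fun v => lbs / 2 + a * (w v + t * f v - (lb - t) / 2) with hws
  have hlow : ∀ u v, ws u + ws v - lbs = a * (w u + t * f u + (w v + t * f v) - (lb - t)) := by
    intro u v
    simp only [hws]
    ring
  have hupp : ∀ u v, ws u + ws v - ubs = a * (w u + t * f u + (w v + t * f v) - (ub + t)) := by
    intro u v
    simp only [hws]
    linear_combination haD
  have key' : ∀ u v,
      (lb ≤ w u + w v → lbs < ws u + ws v) ∧ (w u + w v < lb → ws u + ws v < lbs) ∧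
      (w u + w v ≤ ub → ws u + ws v < ubs) ∧ (ub < w u + w v → ubs < ws u + ws v) := by
    intro u v
    obtain ⟨k₁, k₂, k₃, k₄⟩ := key u v
    have hl := hlow u v
    have hu := hupp u v
    refine ⟨fun h => ?_, fun h => ?_, fun h => ?_, fun h => ?_⟩
    · linarith [hpos _ (k₁ h)]
    · linarith [hpos _ (k₂ h)]
    · linarith [hpos _ (k₃ h)]
    · linarith [hpos _ (k₄ h)]
  refine ⟨ws, fun u v => ?_, fun u v => ?_, fun u v h => ?_⟩
  · obtain ⟨k₁, k₂, k₃, k₄⟩ := key' u v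
    refine ⟨fun h => ⟨(k₁ h.1).le, (k₃ h.2).le⟩, fun h => ⟨?_, ?_⟩⟩
    · exact le_of_not_gt fun h' => (k₂ h').not_ge h.1
    · exact le_of_not_gt fun h' => (k₄ h').not_ge h.2
  · obtain ⟨k₁, k₂, k₃, k₄⟩ := key' u v
    constructor
    · exact (lt_or_ge (w u + w v) lb).elim (fun h => (k₂ h).ne) fun h => (k₁ h).ne'
    · exact (lt_or_ge ub (w u + w v)).elim (fun h => (k₄ h).ne') fun h => (k₃ h).ne
  · have h' : w u + t * f u = w v + t * f v := by
      have := mul_left_cancel₀ ha.ne' (add_left_cancel h)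
      linarith
    have := hft u
    have := hft v
    have huv := h₃ (u, v)
    have hvu := h₃ (v, u)
    simp only [sub_pos] at huv hvu
    rcases lt_trichotomy (w u) (w v) with hlt' | heq | hgt
    · linarith [hvu hlt']
    · rw [heq] at h'
      exact hf (mul_left_cancel₀ ht.ne' (add_left_cancel h'))
    · linarith [huv hgt]

/-- If `w`, `lb`, `ub` define `G` as a double-threshold graph, then for any target bounds
`lb* < ub*` there is a weight function `w*` defining `G` with those bounds, preserving the
set of mid-weight vertices, avoiding weight sums equal to the bounds, and injective. -/
theorem dtg_nice_representation {V : Type*} [Fintype V] (G : SimpleGraph V)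
    (w : V → ℝ) (lb ub : ℝ) (hdef : DefinesDTG G w lb ub)
    (lbs ubs : ℝ) (hlt : lbs < ubs) :
    ∃ ws : V → ℝ, DefinesDTG G ws lbs ubs ∧
      {v : V | lb / 2 ≤ w v ∧ w v ≤ ub / 2} = {v : V | lbs / 2 ≤ ws v ∧ ws v ≤ ubs / 2} ∧
      (∀ u v : V, ws u + ws v ≠ lbs ∧ ws u + ws v ≠ ubs) ∧
      Function.Injective ws := by
  obtain ⟨ws, hsum, hne, hinj⟩ := exists_injective_weight_sum_mem_iff w lb ub lbs ubs hlt
  refine ⟨ws, fun u v huv => (hdef u v huv).trans (hsum u v), ?_, hne, hinj⟩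
  ext v
  have mid : ∀ a b x : ℝ, (a / 2 ≤ x ∧ x ≤ b / 2) ↔ (a ≤ x + x ∧ x + x ≤ b) := by
    intro a b x
    constructor <;> rintro ⟨_, _⟩ <;> constructor <;> linarith
  simpa only [Set.mem_ofPred_eq, mid] using hsum v v
end

section
/- A double-threshold graph has at most one non-bipartite connected component; equivalently, if G is a double-threshold graph and C, C' are two vertex-disjoint cycles of odd length in G, then C and C' belong to the same connected component of G. -/
def IsDoubleThreshold {V : Type*} (G : SimpleGraph V) : Prop :=
  ∃ (w : V → ℝ) (lb ub : ℝ), DefinesDTG G w lb ub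

/-- A graph is bipartite if its vertex set can be partitioned into two independent sets. -/
def IsBipartiteGraph {V : Type*} (G : SimpleGraph V) : Prop :=
  ∃ f : V → Bool, ∀ u v : V, G.Adj u v → f u ≠ f v

/-- In a double-threshold graph, every non-bipartite induced subgraph has a vertex whose doubled
weight lies between the two thresholds. -/
theorem DefinesDTG.exists_mem_Icc_of_not_isBipartiteGraph {V : Type*} {G : SimpleGraph V}
    {w : V → ℝ} {lb ub : ℝ} (hw : DefinesDTG G w lb ub) {s : Set V}
    (hs : ¬ IsBipartiteGraph (SimpleGraph.induce s G)) :
    ∃ v ∈ s, 2 * w v ∈ Set.Icc lb ub := by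
  by_contra! h
  refine hs ⟨fun v => decide (ub < 2 * w v), fun u v huv heq => ?_⟩
  have hadj : G.Adj u v := huv
  obtain ⟨hl, hu⟩ := (hw u v hadj.ne).1 hadj
  have hiff : ub < 2 * w u ↔ ub < 2 * w v := by simpa using heq
  by_cases hub : ub < 2 * w u
  · linarith [hiff.1 hub]
  · have hlow : ∀ x ∈ s, ¬ ub < 2 * w x → 2 * w x < lb := fun x hx hle =>
      not_le.1 fun hlb => h x hx ⟨hlb, not_lt.1 hle⟩
    linarith [hlow u u.2 hub, hlow v v.2 (mt hiff.2 hub)]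

/-- A double-threshold graph has at most one non-bipartite connected component. -/
theorem dtg_at_most_one_nonbipartite_component {V : Type*} [Fintype V] (G : SimpleGraph V)
    (hG : IsDoubleThreshold G) (c c' : G.ConnectedComponent)
    (hc : ¬ IsBipartiteGraph (SimpleGraph.induce c.supp G))
    (hc' : ¬ IsBipartiteGraph (SimpleGraph.induce c'.supp G)) :
    c = c' := by
  obtain ⟨w, lb, ub, hw⟩ := hG
  obtain ⟨u, hu, hul, huu⟩ := hw.exists_mem_Icc_of_not_isBipartiteGraph hc
  obtain ⟨v, hv, hvl, hvu⟩ := hw.exists_mem_Icc_of_not_isBipartiteGraph hc'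
  rw [SimpleGraph.ConnectedComponent.mem_supp_iff] at hu hv
  rw [← hu, ← hv]
  obtain rfl | hne := eq_or_ne u v
  · rfl
  · exact SimpleGraph.ConnectedComponent.sound
      ((hw u v hne).2 ⟨by linarith, by linarith⟩).reachable
end

section
/- The disjoint union of a double-threshold graph and a bipartite double-threshold graph is a double-threshold graph. That is, if G = (V, E_G) is a double-threshold graph and H = (X ∪ Y, E_H) is a bipartite double-threshold graph with bipartition (X, Y), then the disjoint union of G and H (the graph on the disjoint union of their vertex sets whose edges are exactly those of G and those of H) is a double-threshold graph. -/
open Filter Topology in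
/-- On a finite vertex set the two thresholds may be taken to be distinct and in order. -/
theorem IsDoubleThreshold.exists_lt {V : Type*} [Finite V] {G : SimpleGraph V}
    (hG : IsDoubleThreshold G) :
    ∃ (w : V → ℝ) (lb ub : ℝ), lb < ub ∧ DefinesDTG G w lb ub := by
  obtain ⟨w, lb, ub, h⟩ := hG
  rcases lt_or_ge ub lb with hlt | hle
  · refine ⟨fun _ => 0, 1, 2, by norm_num, fun u v huv => ?_⟩
    rw [h u v huv]
    constructor <;> rintro ⟨h1, h2⟩ <;> linarith
  · have hev : ∀ᶠ b in 𝓝[>] ub, ∀ p : V × V, ub < w p.1 + w p.2 → b < w p.1 + w p.2 := by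
      rw [eventually_all]
      intro p
      by_cases hp : ub < w p.1 + w p.2
      · filter_upwards [nhdsWithin_le_nhds (Iio_mem_nhds hp)] with b hb _ using hb
      · exact Eventually.of_forall fun _ h' => absurd h' hp
    obtain ⟨b, hb, hub⟩ := (hev.and self_mem_nhdsWithin).exists
    have hub' : ub < b := hub
    refine ⟨w, lb, b, hle.trans_lt hub', fun u v huv => ?_⟩
    rw [h u v huv]
    refine and_congr_right fun _ => ⟨fun h' => h'.trans hub'.le, fun h' => ?_⟩
    by_contra! hc
    exact (hb (u, v) hc).not_ge h'

/-- On a finite vertex set the thresholds may be taken to be `-1` and `1`. -/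
theorem IsDoubleThreshold.exists_definesDTG_neg_one_one {V : Type*} [Finite V]
    {G : SimpleGraph V} (hG : IsDoubleThreshold G) :
    ∃ w : V → ℝ, DefinesDTG G w (-1) 1 := by
  obtain ⟨w, lb, ub, hlt, h⟩ := hG.exists_lt
  have hpos : 0 < ub - lb := sub_pos.2 hlt
  refine ⟨fun v => (2 * w v - (lb + ub) / 2) / (ub - lb), fun u v huv => ?_⟩
  rw [h u v huv, ← add_div, le_div_iff₀ hpos, div_le_iff₀ hpos]
  constructor <;> rintro ⟨h1, h2⟩ <;> constructor <;> linarith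

/-- Moving the two sides of a bipartite graph apart by opposite shifts keeps the sums across the
bipartition and takes all other sums out of the range of the thresholds. -/
theorem DefinesDTG.sum_bipartite {V W : Type*} {G : SimpleGraph V} {H : SimpleGraph W}
    {w : V → ℝ} {x : W → ℝ} (hw : DefinesDTG G w (-1) 1) (hx : DefinesDTG H x (-1) 1)
    {f : W → Bool} (hf : ∀ u v, H.Adj u v → f u ≠ f v) {M : ℝ}
    (hwM : ∀ v, |w v| ≤ M) (hxM : ∀ v, |x v| ≤ M) :
    DefinesDTG (G ⊕g H)
      (Sum.elim w fun v => x v + if f v then 2 * M + 2 else -(2 * M + 2)) (-1) 1 := by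
  rintro (u | u) (v | v) huv
  · simpa using hw u v (by simpa using huv)
  · have hu := abs_le.1 (hwM u)
    have hv := abs_le.1 (hxM v)
    simp only [SimpleGraph.sum_adj, Sum.elim_inl, Sum.elim_inr]
    split_ifs <;> simp only [false_iff] <;> rintro ⟨h1, h2⟩ <;> linarith
  · have hu := abs_le.1 (hxM u)
    have hv := abs_le.1 (hwM v)
    simp only [SimpleGraph.sum_adj, Sum.elim_inl, Sum.elim_inr]
    split_ifs <;> simp only [false_iff] <;> rintro ⟨h1, h2⟩ <;> linarith
  · have hu := abs_le.1 (hxM u)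
    have hv := abs_le.1 (hxM v)
    have huv' : H.Adj u v ↔ _ := hx u v (by simpa using huv)
    have hfuv := hf u v
    simp only [SimpleGraph.sum_adj, Sum.elim_inr]
    cases hfu : f u <;> cases hfv : f v <;> simp only [hfu, hfv, ne_eq, not_true, imp_false] at hfuv
    · simp only [hfuv, false_iff]
      rintro ⟨h1, h2⟩
      norm_num at h1 h2
      linarith
    · rw [huv']
      norm_num
      constructor <;> rintro ⟨h1, h2⟩ <;> constructor <;> linarith
    · rw [huv']
      norm_num
      constructor <;> rintro ⟨h1, h2⟩ <;> constructor <;> linarith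
    · simp only [hfuv, false_iff]
      rintro ⟨h1, h2⟩
      norm_num at h1 h2
      linarith

/-- The disjoint union of a double-threshold graph and a bipartite double-threshold graph
is a double-threshold graph. -/
theorem dtg_disjoint_union_with_bipartite {V W : Type*} [Fintype V] [Fintype W]
    (G : SimpleGraph V) (H : SimpleGraph W)
    (hG : IsDoubleThreshold G) (hH : IsDoubleThreshold H) (hHbip : IsBipartiteGraph H) :
    IsDoubleThreshold (G ⊕g H) := by
  obtain ⟨w, hw⟩ := hG.exists_definesDTG_neg_one_one
  obtain ⟨x, hx⟩ := hH.exists_definesDTG_neg_one_one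
  obtain ⟨f, hf⟩ := hHbip
  obtain ⟨M, hM⟩ := Finite.exists_le fun a : V ⊕ W => |Sum.elim w x a|
  exact ⟨_, -1, 1, hw.sum_bipartite hx hf (fun v => hM (.inl v)) fun v => hM (.inr v)⟩
end

section
/- A finite simple graph G is a double-threshold graph if and only if G contains at most one non-bipartite connected component and, for every connected component C of G, the induced subgraph of G on C is a double-threshold graph. -/
theorem IsDoubleThreshold.induce {V : Type*} {G : SimpleGraph V} (h : IsDoubleThreshold G)
    (s : Set V) : IsDoubleThreshold (G.induce s) := by
  obtain ⟨w, lb, ub, h⟩ := h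
  exact ⟨fun v => w v, lb, ub, fun u v huv => h u v (Subtype.coe_injective.ne huv)⟩

theorem DefinesDTG.exists_mem_of_not_isBipartiteGraph {V : Type*} {G : SimpleGraph V}
    {w : V → ℝ} {lb ub : ℝ} (h : DefinesDTG G w lb ub) {s : Set V}
    (hs : ¬ IsBipartiteGraph (G.induce s)) : ∃ v ∈ s, lb ≤ 2 * w v ∧ 2 * w v ≤ ub := by
  classical
  by_contra! hne
  refine hs ⟨fun v => decide (lb + ub ≤ 4 * w v), fun u v huv hf => ?_⟩
  have hadj : G.Adj u v := huv
  obtain ⟨h₁, h₂⟩ := (h u v hadj.ne).1 hadj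
  have hu := hne u u.2
  have hv := hne v v.2
  rw [decide_eq_decide] at hf
  by_cases hc : lb + ub ≤ 4 * w u
  · have hc' := hf.1 hc
    linarith [hu (by linarith), hv (by linarith)]
  · have hc' := mt hf.2 hc
    push Not at hc hc'
    rcases le_total (w u) (w v) with hle | hle
    · linarith [hv (by linarith)]
    · linarith [hu (by linarith)]

/-- A finite double-threshold graph admits weights for the thresholds `-1` and `1`. -/
theorem IsDoubleThreshold.exists_abs_add_le_one {V : Type*} [Finite V] {G : SimpleGraph V}
    (h : IsDoubleThreshold G) :
    ∃ w : V → ℝ, ∀ u v, u ≠ v → (G.Adj u v ↔ |w u + w v| ≤ 1) := by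
  obtain ⟨w, lb, ub, h⟩ := h
  rcases lt_or_ge ub lb with hlt | hle
  · refine ⟨fun _ => 1, fun u v huv => ?_⟩
    rw [h u v huv]
    refine iff_of_false (fun hh => by linarith) ?_
    norm_num
  set m := (lb + ub) / 2 with hm
  set d := (ub - lb) / 2 with hd
  have hev : ∀ᶠ e in nhdsWithin (0 : ℝ) (Set.Ioi 0),
      ∀ u v : V, |w u + w v - m| ≤ d + e → |w u + w v - m| ≤ d := by
    rw [Filter.eventually_all]
    intro u
    rw [Filter.eventually_all]
    intro v
    by_cases hs : |w u + w v - m| ≤ d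
    · exact Filter.Eventually.of_forall fun _ _ => hs
    · have hpos : 0 < |w u + w v - m| - d := by linarith [not_le.1 hs]
      filter_upwards [mem_nhdsWithin_of_mem_nhds (Iio_mem_nhds hpos)] with e he hh
      have : e < |w u + w v - m| - d := he
      linarith
  obtain ⟨e, he, hpos⟩ := (hev.and self_mem_nhdsWithin).exists
  have hpos : 0 < e := hpos
  have hde : 0 < d + e := by linarith
  refine ⟨fun v => (w v - m / 2) / (d + e), fun u v huv => ?_⟩
  have hsum : (w u - m / 2) / (d + e) + (w v - m / 2) / (d + e) = (w u + w v - m) / (d + e) := by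
    ring
  rw [hsum, abs_div, abs_of_pos hde, div_le_one hde, h u v huv]
  constructor
  · rintro ⟨h₁, h₂⟩
    rw [abs_le]
    constructor <;> linarith
  · intro hh
    have := abs_le.1 (he u v hh)
    constructor <;> linarith [this.1, this.2]

/-- If at most one component is non-bipartite, the vertices can be labelled by integers so that
adjacent vertices get opposite labels and opposite labels only occur within a component. -/
theorem exists_int_label {V : Type*} [Finite V] (G : SimpleGraph V)
    (h : ∀ c c' : G.ConnectedComponent, ¬ IsBipartiteGraph (G.induce c.supp) →
      ¬ IsBipartiteGraph (G.induce c'.supp) → c = c') :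
    ∃ k : V → ℤ, (∀ u v, G.Adj u v → k u + k v = 0) ∧
      ∀ u v, k u + k v = 0 → G.connectedComponentMk u = G.connectedComponentMk v := by
  classical
  have hsign : ∀ c : G.ConnectedComponent, ∃ g : V → ℤ,
      (∀ u ∈ c.supp, ∀ v ∈ c.supp, G.Adj u v → g u + g v = 0) ∧
      ((∀ v ∈ c.supp, |g v| = 1) ∨ (¬ IsBipartiteGraph (G.induce c.supp) ∧ ∀ v, g v = 0)) := by
    intro c
    by_cases hc : IsBipartiteGraph (G.induce c.supp)
    · obtain ⟨f, hf⟩ := hc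
      refine ⟨fun v => if hv : v ∈ c.supp then (if f ⟨v, hv⟩ then 1 else -1) else 0, ?_,
        Or.inl ?_⟩
      · intro u hu v hv huv
        have := hf ⟨u, hu⟩ ⟨v, hv⟩ huv
        simp only [hu, hv, dif_pos]
        cases h₁ : f ⟨u, hu⟩ <;> cases h₂ : f ⟨v, hv⟩ <;> simp_all
      · intro v hv
        simp only [hv, dif_pos]
        split_ifs <;> simp
    · exact ⟨fun _ => 0, by simp, Or.inr ⟨hc, fun _ => rfl⟩⟩
  choose g hg hg' using hsign
  obtain ⟨n, ⟨e⟩⟩ := Finite.exists_equiv_fin G.ConnectedComponent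
  let k : V → ℤ := fun v =>
    g (G.connectedComponentMk v) v * ((e (G.connectedComponentMk v) : ℕ) + 1 : ℤ)
  refine ⟨k, fun u v huv => ?_, fun u v huv => ?_⟩
  · have hc : G.connectedComponentMk u = G.connectedComponentMk v :=
      SimpleGraph.ConnectedComponent.sound huv.reachable
    have := hg (G.connectedComponentMk v) u hc v rfl huv
    simp only [k, hc]
    rw [← add_mul, this, zero_mul]
  · have habs : |k u| = |k v| := by rw [eq_neg_of_add_eq_zero_left huv, abs_neg]
    have hval : ∀ v, |k v| = |g (G.connectedComponentMk v) v| *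
        ((e (G.connectedComponentMk v) : ℕ) + 1 : ℤ) := fun v => by
      simp only [k]
      rw [abs_mul, abs_of_nonneg (a := (((e (G.connectedComponentMk v) : ℕ) : ℤ) + 1))
        (by positivity)]
    rw [hval, hval] at habs
    rcases hg' (G.connectedComponentMk u) with hu | ⟨hu, hu'⟩ <;>
      rcases hg' (G.connectedComponentMk v) with hv | ⟨hv, hv'⟩
    · rw [hu u rfl, hv v rfl] at habs
      exact e.injective (Fin.ext (by omega))
    · rw [hu u rfl, hv' v, abs_zero] at habs
      omega
    · rw [hv v rfl, hu' u, abs_zero] at habs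
      omega
    · exact h _ _ hu hv

/-- A graph is a double-threshold graph iff it has at most one non-bipartite connected
component and the induced subgraph on every connected component is a double-threshold
graph. -/
theorem dtg_iff_components {V : Type*} [Fintype V] (G : SimpleGraph V) :
    IsDoubleThreshold G ↔
      ((∀ c c' : G.ConnectedComponent,
          ¬ IsBipartiteGraph (SimpleGraph.induce c.supp G) →
          ¬ IsBipartiteGraph (SimpleGraph.induce c'.supp G) → c = c') ∧
        ∀ c : G.ConnectedComponent, IsDoubleThreshold (SimpleGraph.induce c.supp G)) := by
  refine ⟨fun h => ⟨fun c c' hc hc' => ?_, fun c => h.induce _⟩, fun ⟨hbip, hcomp⟩ => ?_⟩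
  · obtain ⟨w, lb, ub, h⟩ := h
    obtain ⟨u, hu, hul, huu⟩ := h.exists_mem_of_not_isBipartiteGraph hc
    obtain ⟨v, hv, hvl, hvu⟩ := h.exists_mem_of_not_isBipartiteGraph hc'
    rw [SimpleGraph.ConnectedComponent.mem_supp_iff] at hu hv
    rw [← hu, ← hv]
    by_cases huv : u = v
    · rw [huv]
    · exact SimpleGraph.ConnectedComponent.sound
        ((h u v huv).2 ⟨by linarith, by linarith⟩).reachable
  · obtain ⟨k, hk, hk'⟩ := exists_int_label G hbip
    choose w hw using fun c => (hcomp c).exists_abs_add_le_one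
    let x : V → ℝ := fun v => w (G.connectedComponentMk v) ⟨v, rfl⟩
    have hx : ∀ u v, u ≠ v → G.connectedComponentMk u = G.connectedComponentMk v →
        (G.Adj u v ↔ |x u + x v| ≤ 1) := by
      intro u v huv hc
      have hxc : ∀ c, ∀ hu : u ∈ c.supp, x u = w c ⟨u, hu⟩ := by
        rintro c rfl
        rfl
      rw [hxc _ hc]
      exact hw (G.connectedComponentMk v) ⟨u, hc⟩ ⟨v, rfl⟩ fun hh => huv (congrArg Subtype.val hh)
    obtain ⟨B, hB⟩ := Finite.exists_le fun v => |x v|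
    refine ⟨fun v => x v + k v * (2 * B + 2), -1, 1, fun u v huv => ?_⟩
    have hsum : x u + k u * (2 * B + 2) + (x v + k v * (2 * B + 2)) =
        x u + x v + ((k u + k v : ℤ) : ℝ) * (2 * B + 2) := by
      push_cast
      ring
    rw [hsum, ← abs_le]
    by_cases h₀ : k u + k v = 0
    · rw [h₀, Int.cast_zero, zero_mul, add_zero]
      exact hx u v huv (hk' u v h₀)
    · refine iff_of_false (fun h => h₀ (hk u v h)) fun h => ?_
      have hBu := hB u
      have hBv := hB v
      have hB₀ : 0 ≤ B := (abs_nonneg _).trans hBu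
      rw [abs_le] at h hBu hBv
      rcases lt_or_gt_of_ne h₀ with hneg | hpos
      · have : ((k u + k v : ℤ) : ℝ) ≤ -1 := by exact_mod_cast Int.le_sub_one_of_lt hneg
        nlinarith
      · have : (1 : ℝ) ≤ ((k u + k v : ℤ) : ℝ) := by exact_mod_cast hpos
        nlinarith
end

section
/- Let G be a bipartite permutation graph with bipartition (X, Y). Then G can be represented by a permutation diagram in which every vertex of X corresponds to a segment of slope-pattern x₂ = x₁ + 1 and every vertex of Y to one of slope-pattern x₂ = x₁ − 1. Precisely, there exist functions x₁, x₂ : X ∪ Y → ℝ with x₁ injective and x₂ injective, such that x₂(x) = x₁(x) + 1 for all x ∈ X, x₂(y) = x₁(y) − 1 for all y ∈ Y, and for all distinct vertices u, v: uv ∈ E if and only if (x₁(u) − x₁(v))·(x₂(u) − x₂(v)) < 0. -/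
def IsPermutationGraph {V : Type*} (G : SimpleGraph V) : Prop :=
  ∃ x₁ x₂ : V → ℝ, Function.Injective x₁ ∧ Function.Injective x₂ ∧
    ∀ u v : V, u ≠ v → (G.Adj u v ↔ (x₁ u - x₁ v) * (x₂ u - x₂ v) < 0)

/-- Suppose that `p` and `q` order `X` in the same way and `Xᶜ` in the same way, and that no pair
`x ∈ X`, `y ∉ X` satisfies `p y < p x` and `q x ≤ q y`. Then there is `f` ordered as `p` such that
`f x + 2` (for `x ∈ X`) and `f y` (for `y ∉ X`) are ordered as `q`. The last conjunct is what allows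
the induction, on the vertices in increasing order of `p`, to go through. -/
theorem exists_shift_realization {V : Type*} (X : Set V) (p q : V → ℝ)
    (hp : Function.Injective p) (S : Finset V)
    (hside : ∀ u ∈ S, ∀ v ∈ S, (u ∈ X ↔ v ∈ X) → (p u < p v ↔ q u < q v))
    (hdir : ∀ x ∈ S, ∀ y ∈ S, x ∈ X → y ∉ X → p y < p x → q y < q x) :
    ∃ f : V → ℝ, (∀ u ∈ S, ∀ v ∈ S, p u < p v → f u < f v) ∧
      (∀ x ∈ S, ∀ y ∈ S, x ∈ X → y ∉ X → q x < q y → f x + 2 < f y) ∧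
      (∀ x ∈ S, ∀ y ∈ S, x ∈ X → y ∉ X → q y < q x → f y < f x + 2) ∧
      (∀ x ∈ S, ∀ x' ∈ S, x ∈ X → x' ∈ X →
        (∀ y ∈ S, y ∉ X → p y < p x' → q y < q x) → f x' < f x + 2) := by
  classical
  induction S using Finset.induction_on_max_value p with
  | empty => simp
  | insert a s ha hmax ih =>
    obtain ⟨f, h1, h2, h3, h4⟩ := ih
      (fun u hu v hv => hside u (Finset.mem_insert_of_mem hu) v (Finset.mem_insert_of_mem hv))
      (fun x hx y hy => hdir x (Finset.mem_insert_of_mem hx) y (Finset.mem_insert_of_mem hy))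
    have hlt : ∀ u ∈ s, p u < p a := fun u hu =>
      lt_of_le_of_ne (hmax u hu) fun h => ha (hp h ▸ hu)
    have hne : ∀ u ∈ s, u ≠ a := fun u hu h => ha (h ▸ hu)
    have hmono : ∀ u ∈ s, ∀ v ∈ s, p u ≤ p v → f u ≤ f v := fun u hu v hv h => by
      rcases h.lt_or_eq with h | h
      · exact (h1 u hu v hv h).le
      · exact (congrArg f (hp h)).le
    have hm : a ∈ insert a s := Finset.mem_insert_self a s
    have hs : ∀ u ∈ s, u ∈ insert a s := fun u hu => Finset.mem_insert_of_mem hu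
    by_cases haX : a ∈ X
    · obtain ⟨m, hlo, hhi⟩ := Order.exists_between_finsets (s.image f)
        ((s.filter fun x => x ∈ X ∧ ∀ y ∈ s, y ∉ X → q y < q x).image fun x => f x + 2) (by
          simp only [Finset.mem_image, Finset.mem_filter]
          rintro _ ⟨u, hu, rfl⟩ _ ⟨x, ⟨hx, hxX, hxy⟩, rfl⟩
          by_cases huX : u ∈ X
          · exact h4 x hx u hu hxX huX fun y hy hyX _ => hxy y hy hyX
          · exact h3 x hx u hu hxX huX (hxy u hu huX))
      simp only [Finset.mem_image, Finset.mem_filter, forall_exists_index, and_imp,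
        forall_apply_eq_imp_iff₂] at hlo hhi
      have hupd : ∀ u ∈ s, Function.update f a m u = f u := fun u hu =>
        Function.update_of_ne (hne u hu) _ _
      have hq : ∀ y ∈ s, y ∉ X → q y < q a := fun y hy hyX =>
        hdir a hm y (hs y hy) haX hyX (hlt y hy)
      refine ⟨Function.update f a m, ?_, ?_, ?_, ?_⟩ <;>
        simp only [Finset.forall_mem_insert, Function.update_self] <;> grind
    · obtain ⟨m, hlo, hhi⟩ := Order.exists_between_finsets
        (s.image f ∪ (s.filter fun x => x ∈ X ∧ q x < q a).image fun x => f x + 2)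
        ((s.filter fun x => x ∈ X ∧ q a < q x).image fun x => f x + 2) (by
          simp only [Finset.mem_union, Finset.mem_image, Finset.mem_filter]
          rintro _ (⟨u, hu, rfl⟩ | ⟨u, ⟨hu, huX, hua⟩, rfl⟩) _ ⟨x, ⟨hx, hxX, hxa⟩, rfl⟩
          · by_cases huX : u ∈ X
            · refine h4 x hx u hu hxX huX fun y hy hyX _ => lt_trans ?_ hxa
              exact (hside y (hs y hy) a hm (by simp [hyX, haX])).1 (hlt y hy)
            · refine h3 x hx u hu hxX huX (lt_trans ?_ hxa)
              exact (hside u (hs u hu) a hm (by simp [huX, haX])).1 (hlt u hu)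
          · have := h1 u hu x hx
              ((hside u (hs u hu) x (hs x hx) (by simp [huX, hxX])).2 (hua.trans hxa))
            linarith)
      simp only [Finset.mem_union, Finset.mem_image, Finset.mem_filter, or_imp, forall_and,
        forall_exists_index, and_imp, forall_apply_eq_imp_iff₂] at hlo hhi
      obtain ⟨hlo, hlo'⟩ := hlo
      have hupd : ∀ u ∈ s, Function.update f a m u = f u := fun u hu =>
        Function.update_of_ne (hne u hu) _ _
      refine ⟨Function.update f a m, ?_, ?_, ?_, ?_⟩ <;>
        simp only [Finset.forall_mem_insert, Function.update_self] <;> grind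

/-- A permutation diagram in which all edges inside `S` are oriented from `X` to `Xᶜ` yields a
representation of the graph on `S` by the condition `f x < f y < f x + 2`. -/
theorem exists_unit_realization {V : Type*} (G : SimpleGraph V) (X : Set V)
    (hbip : ∀ u v : V, G.Adj u v → (u ∈ X ↔ v ∉ X)) (p q : V → ℝ)
    (hp : Function.Injective p) (hq : Function.Injective q)
    (hadj : ∀ u v : V, u ≠ v → (G.Adj u v ↔ (p u - p v) * (q u - q v) < 0)) (S : Finset V)
    (hdir : ∀ x ∈ S, ∀ y ∈ S, x ∈ X → y ∉ X → p y < p x → q y < q x) :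
    ∃ f : V → ℝ, (∀ u ∈ S, ∀ v ∈ S, f u = f v → u = v) ∧
      ∀ x ∈ S, ∀ y ∈ S, x ∈ X → y ∉ X →
        f x + 2 ≠ f y ∧ (G.Adj x y ↔ f x < f y ∧ f y < f x + 2) := by
  have hside : ∀ u v : V, (u ∈ X ↔ v ∈ X) → (p u < p v ↔ q u < q v) := by
    intro u v huv
    rcases eq_or_ne u v with rfl | hne
    · simp
    have hna : ¬ G.Adj u v := fun h => by have := hbip u v h; tauto
    rw [hadj u v hne, mul_neg_iff] at hna
    grind [hp.ne hne, hq.ne hne]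
  obtain ⟨f, h1, h2, h3, -⟩ := exists_shift_realization X p q hp S
    (fun u _ v _ => hside u v) hdir
  refine ⟨f, fun u hu v hv h => ?_, fun x hx y hy hxX hyX => ?_⟩
  · by_contra hne
    rcases (hp.ne hne).lt_or_gt with h' | h'
    · exact (h1 u hu v hv h').ne h
    · exact (h1 v hv u hu h').ne' h
  · have hne : x ≠ y := fun h => hyX (h ▸ hxX)
    rw [hadj x y hne, mul_neg_iff]
    have := h1 x hx y hy
    have := h1 y hy x hx
    have := h2 x hx y hy hxX hyX
    have := h3 x hx y hy hxX hyX
    have := hdir x hx y hy hxX hyX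
    rcases (hp.ne hne).lt_or_gt with h | h <;> rcases (hq.ne hne).lt_or_gt with h' | h' <;> grind

/-- A bipartite permutation graph with bipartition `(X, Xᶜ)` has a permutation diagram in
which vertices of `X` satisfy `x₂ = x₁ + 1` and vertices of `Xᶜ` satisfy `x₂ = x₁ - 1`. -/
theorem bipartite_permutation_right_angle_rep {V : Type*} [Fintype V]
    (G : SimpleGraph V) (X : Set V)
    (hbip : ∀ u v : V, G.Adj u v → (u ∈ X ↔ v ∉ X))
    (hperm : IsPermutationGraph G) :
    ∃ x₁ x₂ : V → ℝ, Function.Injective x₁ ∧ Function.Injective x₂ ∧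
      (∀ v ∈ X, x₂ v = x₁ v + 1) ∧ (∀ v ∉ X, x₂ v = x₁ v - 1) ∧
      ∀ u v : V, u ≠ v → (G.Adj u v ↔ (x₁ u - x₁ v) * (x₂ u - x₂ v) < 0) := by
  classical
  obtain ⟨p, q, hp, hq, hadj⟩ := hperm
  have hcross : ∀ u v, G.Adj u v ↔ (p u < p v ∧ q v < q u) ∨ (p v < p u ∧ q u < q v) := by
    intro u v
    rcases eq_or_ne u v with rfl | hne
    · simp
    · rw [hadj u v hne, mul_neg_iff]
      grind
  -- The vertices lying on an edge whose orientation has to be reversed.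
  let B : Finset V := Finset.univ.filter fun v => ∃ w, G.Adj v w ∧ (v ∈ X ↔ p w < p v)
  have hB : ∀ v, v ∈ B ↔ ∃ w, G.Adj v w ∧ (v ∈ X ↔ p w < p v) := fun v => by simp [B]
  have hedge : ∀ x y, x ∈ X → y ∉ X → G.Adj x y →
      (x ∈ B ↔ p y < p x) ∧ (y ∈ B ↔ p y < p x) := by
    intro x y hx hy h
    refine ⟨⟨fun hxB => ?_, fun hlt => (hB x).2 ⟨y, h, by simp [hx, hlt]⟩⟩,
      ⟨fun hyB => ?_, fun hlt => (hB y).2 ⟨x, h.symm, by simp [hy, hlt.le]⟩⟩⟩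
    · obtain ⟨w, hw, hwp⟩ := (hB x).1 hxB
      by_contra hlt
      have hwX := hbip x w hw
      have : ¬ G.Adj w y := fun h' => by have := hbip w y h'; tauto
      grind
    · obtain ⟨w, hw, hwp⟩ := (hB y).1 hyB
      by_contra hlt
      have hwX := hbip y w hw
      have : ¬ G.Adj x w := fun h' => by have := hbip x w h'; tauto
      grind
  obtain ⟨f, hf, hf'⟩ := exists_unit_realization G X hbip p q hp hq hadj Bᶜ (by
    intro x hx y hy hxX hyX h
    by_contra hlt
    have hne : x ≠ y := fun h => hyX (h ▸ hxX)
    have hxy : G.Adj x y :=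
      (hcross x y).2 (.inr ⟨h, (hq.ne hne).lt_of_le (not_lt.1 hlt)⟩)
    exact Finset.mem_compl.1 hx ((hedge x y hxX hyX hxy).1.2 h))
  obtain ⟨g, hg, hg'⟩ := exists_unit_realization G X hbip q p hq hp
    (fun u v h => by rw [hadj u v h, mul_comm]) B (by
    intro x hx y hy hxX hyX h
    by_contra hlt
    have hne : x ≠ y := fun h => hyX (h ▸ hxX)
    have hxy : G.Adj x y :=
      (hcross x y).2 (.inl ⟨(hp.ne hne).lt_of_le (not_lt.1 hlt), h⟩)
    exact hlt ((hedge x y hxX hyX hxy).1.1 hx))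
  obtain ⟨M, hM⟩ : ∃ M, ∀ u v, f u + 2 < g v + M := by
    obtain ⟨M, hM⟩ := (Set.finite_range fun uv : V × V => f uv.1 + 2 - g uv.2).bddAbove
    refine ⟨M + 1, fun u v => ?_⟩
    have := hM ⟨(u, v), rfl⟩
    dsimp only at this
    linarith
  obtain ⟨F, hF, hF'⟩ : ∃ F : V → ℝ, Function.Injective F ∧ ∀ x y, x ∈ X → y ∉ X →
      F x + 2 ≠ F y ∧ (G.Adj x y ↔ F x < F y ∧ F y < F x + 2) := by
    simp only [Finset.mem_compl] at hf hf'
    refine ⟨fun v => if v ∈ B then g v + M else f v, fun u v h => ?_, fun x y hx hy => ?_⟩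
    · have := hM u v
      have := hM v u
      dsimp only at h
      split_ifs at h with hu hv hv
      · exact hg u hu v hv (by linarith)
      · linarith
      · linarith
      · exact hf u hu v hv h
    · have := hM x y
      have := hM y x
      have he := hedge x y hx hy
      dsimp only
      split_ifs with hxB hyB hyB
      · have := hg' x hxB y hyB hx hy
        grind
      · grind
      · grind
      · exact hf' x hxB y hyB hx hy
  refine ⟨F, fun v => if v ∈ X then F v + 1 else F v - 1, hF, ?_, ?_, ?_, ?_⟩
  · intro u v h
    have := hF' u v
    have := hF' v u
    by_cases hu : u ∈ X <;> by_cases hv : v ∈ X <;> simp only [hu, hv, if_true, if_false] at h <;>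
      grind [Function.Injective]
  · intro v hv
    simp [hv]
  · intro v hv
    simp [hv]
  · intro u v hne
    have hb := hbip u v
    have hFne := hF.ne hne
    by_cases hu : u ∈ X <;> by_cases hv : v ∈ X <;> simp only [hu, hv, if_true, if_false]
    · have := mul_self_nonneg (F u - F v)
      grind
    · rw [(hF' u v hu hv).2, mul_neg_iff]
      grind
    · rw [G.adj_comm, (hF' v u hv hu).2, mul_neg_iff]
      grind
    · have := mul_self_nonneg (F u - F v)
      grind
end

section
/- Let G be a connected bipartite permutation graph with bipartition (X, Y), defined by strict linear orders ≺₁ and ≺₂ on its vertex set (i.e., for distinct u, v: uv ∈ E iff (u ≺₁ v and v ≺₂ u) or (u ≺₂ v and v ≺₁ u)). If the ≺₁-minimum vertex belongs to X, then there exist functions x₁, x₂ : X ∪ Y → ℝ such that: x₁ is strictly increasing with respect to ≺₁ (x₁(u) < x₁(v) iff u ≺₁ v), x₂ is strictly increasing with respect to ≺₂, x₂(x) = x₁(x) + 1 for all x ∈ X, x₂(y) = x₁(y) − 1 for all y ∈ Y, and for all distinct u, v: uv ∈ E iff (x₁(u) − x₁(v))·(x₂(u) − x₂(v)) < 0. 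-/
/-- Greedy construction of diagram coordinates along a linear order on `V`, for a second order `r`
that agrees with it inside `X`, inside `Xᶜ`, and on pairs whose smaller element is outside `X`. -/
theorem exists_coordinate_of_finset {V : Type*} [LinearOrder V] (X : Set V) (r : V → V → Prop)
    [IsStrictTotalOrder V r]
    (hX : ∀ u ∈ X, ∀ v ∈ X, u < v → r u v)
    (hY : ∀ u ∉ X, ∀ v ∉ X, u < v → r u v)
    (hYX : ∀ y ∉ X, ∀ x ∈ X, y < x → r y x) (S : Finset V) :
    ∃ p : V → ℝ,
      (∀ u ∈ S, ∀ v ∈ S, u < v → p u < p v) ∧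
      (∀ x ∈ S, ∀ y ∈ S, x ∈ X → y ∉ X → r x y → p x + 2 < p y) ∧
      (∀ x ∈ S, ∀ y ∈ S, x ∈ X → y ∉ X → r y x → p y < p x + 2) ∧
      (∀ u ∈ S, ∀ x ∈ S, ∀ y, x ∈ X → y ∉ X → (∀ s ∈ S, s < y) → r y x → p u < p x + 2) := by
  classical
  have irr : ∀ u, ¬ r u u := irrefl
  have tr : ∀ {u v w}, r u v → r v w → r u w := fun h h' => trans_of r h h'
  have hX' : ∀ u ∈ X, ∀ v ∈ X, r u v → u < v := by
    intro u hu v hv h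
    rcases lt_trichotomy u v with h' | rfl | h'
    · exact h'
    · exact (irr _ h).elim
    · exact (irr _ (tr h (hX v hv u hu h'))).elim
  induction S using Finset.induction_on_max with
  | empty => exact ⟨fun _ => 0, by simp⟩
  | insert a S ha ih =>
    obtain ⟨p, hmono, hlow, hupp, hinv⟩ := ih
    have haS : a ∉ S := fun h => lt_irrefl _ (ha a h)
    obtain ⟨c, hc1, hc2⟩ := Order.exists_between_finsets
      (S.image p ∪ (S.filter (fun x => a ∉ X ∧ x ∈ X ∧ r x a)).image (fun x => p x + 2))
      ((S.filter (fun x => x ∈ X ∧ ∃ y, y ∉ X ∧ a ≤ y ∧ r y x)).image (fun x => p x + 2)) (by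
        intro l hl b hb
        simp only [Finset.mem_union, Finset.mem_image, Finset.mem_filter] at hl hb
        obtain ⟨x, ⟨hxS, hxX, y, hyX, hay, hyx⟩, rfl⟩ := hb
        rcases hl with ⟨u, hu, rfl⟩ | ⟨u, ⟨hu, haX, huX, hua⟩, rfl⟩
        · exact hinv u hu x hxS y hxX hyX (fun s hs => (ha s hs).trans_le hay) hyx
        · have hux : r u x := by
            rcases hay.eq_or_lt with rfl | h
            · exact tr hua hyx
            · exact tr hua (tr (hY a haX y hyX h) hyx)
          have := hmono u hu x hxS (hX' u huX x hxX hux)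
          linarith)
    simp only [Finset.mem_union, Finset.mem_image, Finset.mem_filter] at hc1 hc2
    have hlt : ∀ u ∈ S, p u < c := fun u hu => hc1 _ (Or.inl ⟨u, hu, rfl⟩)
    have hgt : ∀ x ∈ S, ∀ y, x ∈ X → y ∉ X → a ≤ y → r y x → c < p x + 2 :=
      fun x hx y hxX hyX hay hyx => hc2 _ ⟨x, ⟨hx, hxX, y, hyX, hay, hyx⟩, rfl⟩
    have hpa : Function.update p a c a = c := Function.update_self ..
    have hpS : ∀ u ∈ S, Function.update p a c u = p u := fun u hu =>
      Function.update_of_ne (ne_of_mem_of_not_mem hu haS) ..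
    refine ⟨Function.update p a c, ?_, ?_, ?_, ?_⟩
    · intro u hu v hv huv
      rw [Finset.mem_insert] at hu hv
      rcases hu with rfl | hu <;> rcases hv with rfl | hv
      · exact (lt_irrefl _ huv).elim
      · exact (lt_asymm huv (ha v hv)).elim
      · rw [hpa, hpS u hu]; exact hlt u hu
      · rw [hpS u hu, hpS v hv]; exact hmono u hu v hv huv
    · intro x hx y hy hxX hyX h
      rw [Finset.mem_insert] at hx hy
      rcases hx with rfl | hx <;> rcases hy with rfl | hy
      · exact (hyX hxX).elim
      · exact (irr _ (tr h (hYX y hyX x hxX (ha y hy)))).elim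
      · rw [hpa, hpS x hx]; exact hc1 _ (Or.inr ⟨x, ⟨hx, hyX, hxX, h⟩, rfl⟩)
      · rw [hpS x hx, hpS y hy]; exact hlow x hx y hy hxX hyX h
    · intro x hx y hy hxX hyX h
      rw [Finset.mem_insert] at hx hy
      rcases hx with rfl | hx <;> rcases hy with rfl | hy
      · exact (hyX hxX).elim
      · rw [hpa, hpS y hy]; linarith [hlt y hy]
      · rw [hpa, hpS x hx]; exact hgt x hx y hxX hyX le_rfl h
      · rw [hpS x hx, hpS y hy]; exact hupp x hx y hy hxX hyX h
    · intro u hu x hx y hxX hyX hy h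
      have hay : a < y := hy a (Finset.mem_insert_self _ _)
      rw [Finset.mem_insert] at hu hx
      rcases hu with rfl | hu <;> rcases hx with rfl | hx
      · linarith
      · rw [hpa, hpS x hx]; exact hgt x hx y hxX hyX hay.le h
      · rw [hpa, hpS u hu]; linarith [hlt u hu]
      · rw [hpS u hu, hpS x hx]
        exact hinv u hu x hx y hxX hyX (fun s hs => hy s (Finset.mem_insert_of_mem hs)) h

/-- If two strict total orders define a connected bipartite graph and the minimum of the first one
lies in `X`, then in every edge the endpoint in `X` comes first. -/
theorem rel_of_rel_of_notMem_of_mem {V : Type*} (G : SimpleGraph V) (X : Set V)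
    (r₁ r₂ : V → V → Prop) [IsStrictTotalOrder V r₁] [IsStrictTotalOrder V r₂]
    (hconn : G.Connected)
    (hbip : ∀ u v : V, G.Adj u v → (u ∈ X ↔ v ∉ X))
    (hdef : ∀ u v : V, u ≠ v → (G.Adj u v ↔ (r₁ u v ∧ r₂ v u) ∨ (r₂ u v ∧ r₁ v u)))
    (hmin : ∃ m ∈ X, ∀ v : V, v ≠ m → r₁ m v) {x y : V} (hx : x ∈ X) (hy : y ∉ X)
    (hyx : r₁ y x) : r₂ y x := by
  have irr₁ : ∀ u, ¬ r₁ u u := irrefl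
  have tr₁ : ∀ {u v w}, r₁ u v → r₁ v w → r₁ u w := fun h h' => trans_of r₁ h h'
  have tr₂ : ∀ {u v w}, r₂ u v → r₂ v w → r₂ u w := fun h h' => trans_of r₂ h h'
  have hadj : ∀ {u v}, r₁ u v → r₂ v u → G.Adj u v := fun {u v} h h' =>
    (hdef u v (fun e => irr₁ v (e ▸ h))).2 (Or.inl ⟨h, h'⟩)
  obtain ⟨m, hm, hmin⟩ := hmin
  rcases trichotomous_of r₂ y x with h | h | h
  · exact h
  · exact (hy (h ▸ hx)).elim
  exfalso
  have key : ∀ u v, G.Reachable u v →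
      (∃ w, (u ∈ X ∧ w ∉ X ∧ r₁ w u ∧ r₂ u w) ∨ (u ∉ X ∧ w ∈ X ∧ r₁ u w ∧ r₂ w u)) →
      ∃ w, (v ∈ X ∧ w ∉ X ∧ r₁ w v ∧ r₂ v w) ∨ (v ∉ X ∧ w ∈ X ∧ r₁ v w ∧ r₂ w v) := by
    rintro u v ⟨W⟩
    induction W with
    | nil => exact id
    | @cons u v w huv _ ih =>
      rintro ⟨z, ⟨hu, hz, h1, h2⟩ | ⟨hu, hz, h1, h2⟩⟩
      · apply ih
        have hv : v ∉ X := (hbip u v huv).1 hu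
        rcases (hdef u v huv.ne).1 huv with ⟨h3, h4⟩ | ⟨h3, h4⟩
        · exact absurd ((hbip z v (hadj (tr₁ h1 h3) (tr₂ h4 h2))).2 hv) hz
        · exact ⟨u, Or.inr ⟨hv, hu, h4, h3⟩⟩
      · apply ih
        have hv : v ∈ X := by_contra fun hv => hu ((hbip u v huv).2 hv)
        rcases (hdef u v huv.ne).1 huv with ⟨h3, h4⟩ | ⟨h3, h4⟩
        · exact ⟨u, Or.inl ⟨hv, hu, h3, h4⟩⟩
        · exact absurd hz ((hbip v z (hadj (tr₁ h4 h1) (tr₂ h2 h3))).1 hv)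
  obtain ⟨w, ⟨-, hw, h1, -⟩ | ⟨h1, -⟩⟩ :=
    key x m (hconn.preconnected x m) ⟨y, Or.inl ⟨hx, hy, hyx, h⟩⟩
  · exact irr₁ _ (tr₁ h1 (hmin w (fun e => hw (e ▸ hm))))
  · exact h1 hm

/-- A map that preserves a strict total order also reflects it. -/
theorem lt_iff_rel_of_rel_imp_lt {V α : Type*} [Preorder α] {r : V → V → Prop}
    [IsStrictTotalOrder V r] {f : V → α} (hf : ∀ u v, r u v → f u < f v) (u v : V) :
    f u < f v ↔ r u v := by
  refine ⟨fun h => ?_, hf u v⟩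
  rcases trichotomous_of r u v with h' | rfl | h'
  · exact h'
  · exact (lt_irrefl _ h).elim
  · exact (lt_asymm h (hf v u h')).elim


/-- Let `G` be a connected bipartite permutation graph with bipartition `(X, Xᶜ)`,
defined by strict linear orders `r₁` and `r₂`. If the `r₁`-minimum vertex belongs to `X`,
then there is a permutation diagram consistent with `r₁` and `r₂` in which vertices of `X`
satisfy `x₂ = x₁ + 1` and vertices of `Xᶜ` satisfy `x₂ = x₁ - 1`. -/
theorem connected_bipartite_permutation_consistent_right_angle_rep
    {V : Type*} [Fintype V] (G : SimpleGraph V) (X : Set V)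
    (r₁ r₂ : V → V → Prop) [IsStrictTotalOrder V r₁] [IsStrictTotalOrder V r₂]
    (hconn : G.Connected)
    (hbip : ∀ u v : V, G.Adj u v → (u ∈ X ↔ v ∉ X))
    (hdef : ∀ u v : V, u ≠ v → (G.Adj u v ↔ (r₁ u v ∧ r₂ v u) ∨ (r₂ u v ∧ r₁ v u)))
    (hmin : ∃ m ∈ X, ∀ v : V, v ≠ m → r₁ m v) :
    ∃ x₁ x₂ : V → ℝ,
      (∀ u v : V, x₁ u < x₁ v ↔ r₁ u v) ∧
      (∀ u v : V, x₂ u < x₂ v ↔ r₂ u v) ∧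
      (∀ v ∈ X, x₂ v = x₁ v + 1) ∧ (∀ v ∉ X, x₂ v = x₁ v - 1) ∧
      ∀ u v : V, u ≠ v → (G.Adj u v ↔ (x₁ u - x₁ v) * (x₂ u - x₂ v) < 0) := by
  classical
  have hYX : ∀ y ∉ X, ∀ x ∈ X, r₁ y x → r₂ y x := fun y hy x hx =>
    rel_of_rel_of_notMem_of_mem G X r₁ r₂ hconn hbip hdef hmin hx hy
  have irr₁ : ∀ u, ¬ r₁ u u := irrefl
  have hside : ∀ u v, (u ∈ X ↔ v ∈ X) → r₁ u v → r₂ u v := by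
    intro u v huv h
    have hne : u ≠ v := fun e => irr₁ v (e ▸ h)
    rcases trichotomous_of r₂ u v with h' | h' | h'
    · exact h'
    · exact (hne h').elim
    · have := hbip u v ((hdef u v hne).2 (Or.inl ⟨h, h'⟩))
      tauto
  have hside' : ∀ u v, (u ∈ X ↔ v ∈ X) → r₂ u v → r₁ u v := by
    intro u v huv h
    rcases trichotomous_of r₁ u v with h' | rfl | h'
    · exact h'
    · exact (irrefl_of r₂ _ h).elim
    · exact (irrefl_of r₂ _ (trans_of r₂ h (hside v u huv.symm h'))).elim
  let _ : LinearOrder V := linearOrderOfSTO r₁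
  obtain ⟨p, hmono, hlow, hupp, -⟩ := exists_coordinate_of_finset X r₂
    (fun u hu v hv h => hside u v (iff_of_true hu hv) h)
    (fun u hu v hv h => hside u v (iff_of_false hu hv) h) hYX Finset.univ
  simp only [Finset.mem_univ, forall_true_left] at hmono hlow hupp
  have h₁ : ∀ u v, p u < p v ↔ r₁ u v := lt_iff_rel_of_rel_imp_lt hmono
  have h₂ : ∀ u v, (if u ∈ X then p u + 1 else p u - 1) < (if v ∈ X then p v + 1 else p v - 1) ↔
      r₂ u v := by
    apply lt_iff_rel_of_rel_imp_lt
    intro u v h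
    split_ifs with hu hv hv
    · linarith [(h₁ u v).2 (hside' u v (iff_of_true hu hv) h)]
    · linarith [hlow u v hu hv h]
    · linarith [hupp v u hv hu h]
    · linarith [(h₁ u v).2 (hside' u v (iff_of_false hu hv) h)]
  refine ⟨p, fun v => if v ∈ X then p v + 1 else p v - 1, h₁, h₂,
    fun v hv => if_pos hv, fun v hv => if_neg hv, fun u v huv => ?_⟩
  rw [hdef u v huv, mul_neg_iff, sub_pos, sub_neg, sub_neg, sub_pos, h₁, h₂, h₁, h₂]
  tauto
end

section
/- Every double-threshold graph is a permutation graph. -/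
/-- A finite family in a linear order can be represented by real numbers. -/
theorem exists_real_lt_iff_of_finite {V α : Type*} [Finite V] [LinearOrder α] (f : V → α) :
    ∃ x : V → ℝ, ∀ u v, x u < x v ↔ f u < f v := by
  classical
  have := Fintype.ofFinite V
  have mono : ∀ u v, f u ≤ f v →
      (Finset.univ.filter fun t => f t < f u) ⊆ Finset.univ.filter fun t => f t < f v := by
    intro u v h t ht
    simp only [Finset.mem_filter, Finset.mem_univ, true_and] at ht ⊢
    exact ht.trans_le h
  refine ⟨fun v => ((Finset.univ.filter fun t => f t < f v).card : ℝ), fun u v => ?_⟩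
  rw [Nat.cast_lt]
  refine ⟨fun h => ?_, fun h => ?_⟩
  · by_contra! hc
    exact absurd (Finset.card_le_card (mono v u hc)) (not_le.mpr h)
  · refine Finset.card_lt_card ((Finset.ssubset_iff_of_subset (mono u v h.le)).mpr ⟨u, ?_, ?_⟩)
    · simpa using h
    · simp

/-- On a finite type, ties of a real function can be broken by an injective real function. -/
theorem exists_injective_lex_real {V : Type*} [Finite V] (f g : V → ℝ)
    (hg : Function.Injective g) :
    ∃ x : V → ℝ, Function.Injective x ∧
      ∀ u v, x u < x v ↔ f u < f v ∨ f u = f v ∧ g u < g v := by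
  obtain ⟨x, hx⟩ := exists_real_lt_iff_of_finite fun v => toLex (f v, g v)
  simp only [Prod.Lex.toLex_lt_toLex] at hx
  refine ⟨x, fun u v h => hg ?_, hx⟩
  have huv := (hx u v).not.mp h.not_lt
  have hvu := (hx v u).not.mp h.not_gt
  grind

theorem exists_injective_real_Ioo (V : Type*) [Finite V] :
    ∃ e : V → ℝ, Function.Injective e ∧ ∀ v, 0 < e v ∧ e v < 1 := by
  obtain ⟨n, ⟨i⟩⟩ := Finite.exists_equiv_fin V
  refine ⟨fun v => 1 / ((i v : ℕ) + 2 : ℝ), fun u v h => ?_, fun v => ⟨by positivity, ?_⟩⟩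
  · have h' : ((i u : ℕ) : ℝ) = (i v : ℕ) := by
      simpa using h
    exact i.injective (Fin.ext (by exact_mod_cast h'))
  · rw [div_lt_one (by positivity)]
    have : (0 : ℝ) ≤ (i v : ℕ) := by positivity
    linarith

/-- A graph is a permutation graph as soon as it has line representations whose ties are broken
lexicographically. -/
theorem isPermutationGraph_of_lex {V : Type*} [Finite V] (G : SimpleGraph V)
    (f₁ g₁ f₂ g₂ : V → ℝ) (hg₁ : Function.Injective g₁) (hg₂ : Function.Injective g₂)
    (h : ∀ u v, u ≠ v → (G.Adj u v ↔
      (f₁ u < f₁ v ∨ f₁ u = f₁ v ∧ g₁ u < g₁ v) ∧ (f₂ v < f₂ u ∨ f₂ v = f₂ u ∧ g₂ v < g₂ u) ∨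
      (f₁ v < f₁ u ∨ f₁ v = f₁ u ∧ g₁ v < g₁ u) ∧ (f₂ u < f₂ v ∨ f₂ u = f₂ v ∧ g₂ u < g₂ v))) :
    IsPermutationGraph G := by
  obtain ⟨x₁, hx₁, h₁⟩ := exists_injective_lex_real f₁ g₁ hg₁
  obtain ⟨x₂, hx₂, h₂⟩ := exists_injective_lex_real f₂ g₂ hg₂
  refine ⟨x₁, x₂, hx₁, hx₂, fun u v huv => ?_⟩
  rw [h u v huv, mul_neg_iff]
  simp only [sub_pos, sub_neg, h₁, h₂]
  tauto

/-- A double-threshold representation with symmetric thresholds `-c ≤ c` yields a permutation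
graph: heavy vertices become the lines `(w, w + c)`, light ones `(c - w, -w)`, and the remaining
ones `(c - w, c + w)`. -/
theorem isPermutationGraph_of_definesDTG_neg {V : Type*} [Finite V] (G : SimpleGraph V)
    (w : V → ℝ) (c : ℝ) (hc : 0 ≤ c) (hG : DefinesDTG G w (-c) c) : IsPermutationGraph G := by
  classical
  obtain ⟨e, he, he01⟩ := exists_injective_real_Ioo V
  refine isPermutationGraph_of_lex G
    (fun v => if c / 2 < w v then w v else c - w v)
    (fun v => if c / 2 < w v then e v - 1 else e v)
    (fun v => if c / 2 < w v then w v + c else if w v < -(c / 2) then -w v else c + w v)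
    (fun v => if c / 2 < w v then e v else if w v < -(c / 2) then e v - 2 else -e v)
    (fun u v h => he ?_) (fun u v h => he ?_) (fun u v huv => ?_)
  · have hu := he01 u
    have hv := he01 v
    dsimp only at h
    split_ifs at h <;> linarith
  · have hu := he01 u
    have hv := he01 v
    dsimp only at h
    split_ifs at h <;> linarith
  · rw [hG u v huv]
    have hu := he01 u
    have hv := he01 v
    have hne := he.ne huv
    clear hG he he01
    generalize e u = p at *
    generalize e v = q at *
    generalize w u = a at *
    generalize w v = b at *
    split_ifs <;> grind

/-- Every double-threshold graph is a permutation graph. -/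
theorem dtg_is_permutation {V : Type*} [Fintype V] (G : SimpleGraph V)
    (hG : IsDoubleThreshold G) : IsPermutationGraph G := by
  obtain ⟨w, lb, ub, h⟩ := hG
  rcases le_or_gt lb ub with hle | hlt
  · refine isPermutationGraph_of_definesDTG_neg G (fun v => w v - (lb + ub) / 4) ((ub - lb) / 2)
      (by linarith) fun u v huv => ?_
    rw [h u v huv]
    constructor <;> rintro ⟨h₁, h₂⟩ <;> constructor <;> linarith
  · obtain ⟨e, he, -⟩ := exists_injective_real_Ioo V
    refine ⟨e, e, he, he, fun u v huv => ?_⟩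
    rw [h u v huv]
    refine ⟨fun h' => by linarith, fun h' => ?_⟩
    exact absurd h' (mul_self_nonneg _).not_gt
end

section
/- Every bipartite permutation graph is a double-threshold graph. -/
/-- A finite linear order with a strict relation `T` that is monotone (down in the first argument,
up in the second) embeds in `ℝ` so that `T x y` means that `y` lies more than `1` above `x`. -/
theorem exists_unit_representation {α : Type*} [Fintype α] [LinearOrder α] (T : α → α → Prop)
    (hlt : ∀ x y, T x y → x < y)
    (hmono : ∀ x x' y y', x' ≤ x → y ≤ y' → T x y → T x' y') :
    ∃ ψ : α → ℝ, StrictMono ψ ∧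
      ∀ x y, (T x y → ψ x + 1 < ψ y) ∧ (¬ T x y → ψ y < ψ x + 1) := by
  classical
  suffices h : ∀ s : Finset α, ∃ ψ : α → ℝ, (∀ x ∈ s, ∀ y ∈ s, x < y → ψ x < ψ y) ∧
      ∀ x ∈ s, ∀ y ∈ s, (T x y → ψ x + 1 < ψ y) ∧ (¬ T x y → ψ y < ψ x + 1) by
    obtain ⟨ψ, h₁, h₂⟩ := h Finset.univ
    exact ⟨ψ, fun x y hxy => h₁ x (Finset.mem_univ _) y (Finset.mem_univ _) hxy,
      fun x y => h₂ x (Finset.mem_univ _) y (Finset.mem_univ _)⟩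
  intro s
  induction s using Finset.induction_on_max with
  | empty => exact ⟨0, by simp⟩
  | insert m s hm ih =>
    obtain ⟨ψ, hψ, hT⟩ := ih
    obtain ⟨c, hlo, hhi⟩ := Order.exists_between_finsets
      (s.image ψ ∪ (s.filter (T · m)).image (ψ · + 1))
      ((s.filter (¬ T · m)).image (ψ · + 1)) (by
        simp only [Finset.mem_union, Finset.mem_image, Finset.mem_filter]
        rintro _ (⟨y, hy, rfl⟩ | ⟨x, ⟨hx, hxm⟩, rfl⟩) _ ⟨z, ⟨hz, hzm⟩, rfl⟩
        · exact (hT z hz y hy).2 fun h => hzm (hmono z z y m le_rfl (hm y hy).le h)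
        · have : x < z := lt_of_not_ge fun h => hzm (hmono x z m m h le_rfl hxm)
          linarith [hψ x hx z hz this])
    have hbelow : ∀ y ∈ s, ψ y < c := fun y hy =>
      hlo _ (Finset.mem_union_left _ (Finset.mem_image_of_mem _ hy))
    have hfar : ∀ x ∈ s, T x m → ψ x + 1 < c := fun x hx h =>
      hlo _ (Finset.mem_union_right _ (Finset.mem_image.2 ⟨x, Finset.mem_filter.2 ⟨hx, h⟩, rfl⟩))
    have hnear : ∀ x ∈ s, ¬ T x m → c < ψ x + 1 := fun x hx h =>
      hhi _ (Finset.mem_image.2 ⟨x, Finset.mem_filter.2 ⟨hx, h⟩, rfl⟩)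
    have hself : Function.update ψ m c m = c := Function.update_self ..
    have hold : ∀ x ∈ s, Function.update ψ m c x = ψ x := fun x hx =>
      Function.update_of_ne (hm x hx).ne _ _
    refine ⟨Function.update ψ m c, ?_, ?_⟩
    · intro x hx₀ y hy₀ hxy
      rcases Finset.mem_insert.1 hx₀ with rfl | hx <;> rcases Finset.mem_insert.1 hy₀ with rfl | hy
      · exact absurd hxy (lt_irrefl _)
      · exact absurd hxy (hm y hy).not_gt
      · rw [hself, hold x hx]; exact hbelow x hx
      · rw [hold x hx, hold y hy]; exact hψ x hx y hy hxy
    · intro x hx₀ y hy₀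
      rcases Finset.mem_insert.1 hx₀ with rfl | hx <;> rcases Finset.mem_insert.1 hy₀ with rfl | hy
      · exact ⟨fun h => absurd (hlt _ _ h) (lt_irrefl _), fun _ => by linarith⟩
      · refine ⟨fun h => absurd (hlt _ _ h) (hm y hy).not_gt, fun _ => ?_⟩
        rw [hself, hold y hy]; linarith [hbelow y hy]
      · rw [hself, hold x hx]; exact ⟨hfar x hx, hnear x hx⟩
      · rw [hold x hx, hold y hy]; exact hT x hx y hy

/-- A graph whose vertices are split into two independent classes, with adjacency across the
classes given by a window of length `1`, is a double-threshold graph. -/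
theorem IsDoubleThreshold.of_unit_window {V : Type*} [Finite V] (G : SimpleGraph V) (f : V → Bool)
    (hf : ∀ u v, G.Adj u v → f u ≠ f v) (ψ : V → ℝ)
    (hψ : ∀ a b, f a = false → f b = true → (G.Adj a b ↔ ψ a ≤ ψ b ∧ ψ b ≤ ψ a + 1)) :
    IsDoubleThreshold G := by
  obtain ⟨C, hC⟩ := (Set.finite_range fun v => |ψ v|).bddAbove
  have hC' : ∀ v, -C ≤ ψ v ∧ ψ v ≤ C := fun v => abs_le.1 (hC ⟨v, rfl⟩)
  refine ⟨fun v => if f v then ψ v + (C + 1) else -ψ v - (C + 1), 0, 1, fun u v _ => ?_⟩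
  have hu := hC' u
  have hv := hC' v
  cases hfu : f u <;> cases hfv : f v <;> simp only [hfu, hfv, if_true, Bool.false_eq_true, if_false]
  · exact iff_of_false (fun h => hf u v h (hfu.trans hfv.symm)) fun h => by linarith [h.1]
  · rw [hψ u v hfu hfv]
    constructor <;> rintro ⟨h₁, h₂⟩ <;> constructor <;> linarith
  · rw [G.adj_comm, hψ v u hfv hfu]
    constructor <;> rintro ⟨h₁, h₂⟩ <;> constructor <;> linarith
  · exact iff_of_false (fun h => hf u v h (hfu.trans hfv.symm)) fun h => by linarith [h.2]

/-- The order on the vertices of a two-coloured permutation diagram that puts a `false` vertex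
just before its `true` neighbours. -/
def diagramLT {V : Type*} (f : V → Bool) (x₁ x₂ : V → ℝ) (u v : V) : Prop :=
  if f u = false ∧ f v = true then x₁ u < x₁ v ∨ x₂ u < x₂ v else x₁ u < x₁ v ∧ x₂ u < x₂ v

theorem diagramLT_isStrictTotalOrder {V : Type*} (f : V → Bool) (x₁ x₂ : V → ℝ)
    (h₁ : Function.Injective x₁) (h₂ : Function.Injective x₂)
    (hf : ∀ u v, f u = f v → (x₁ u < x₁ v ↔ x₂ u < x₂ v)) :
    IsStrictTotalOrder V (diagramLT f x₁ x₂) where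
  irrefl u := by cases h : f u <;> simp [diagramLT, h]
  trans u v w huv hvw := by
    have := hf u v
    have := hf v w
    have := hf u w
    unfold diagramLT at *
    cases hu : f u <;> cases hv : f v <;> cases hw : f w <;> grind
  trichotomous u v huv hvu := by
    by_contra hne
    have := h₁.ne hne
    have := h₂.ne hne
    have := hf u v
    have := hf v u
    unfold diagramLT at *
    cases hu : f u <;> cases hv : f v <;> grind

/-- Every bipartite permutation graph is a double-threshold graph. -/
theorem bipartite_permutation_is_dtg {V : Type*} [Fintype V] (G : SimpleGraph V)
    (hbip : IsBipartiteGraph G) (hperm : IsPermutationGraph G) :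
    IsDoubleThreshold G := by
  classical
  obtain ⟨f, hf⟩ := hbip
  obtain ⟨x₁, x₂, h₁, h₂, hadj⟩ := hperm
  have hsame : ∀ u v, f u = f v → (x₁ u < x₁ v ↔ x₂ u < x₂ v) := by
    intro u v huv
    rcases eq_or_ne u v with rfl | hne
    · simp
    have hn := fun h => hf u v ((hadj u v hne).2 h) huv
    have hn₁ := h₁.ne hne
    have hn₂ := h₂.ne hne
    constructor <;> intro h <;> by_contra h'
    · exact hn (mul_neg_of_neg_of_pos (by linarith)
        (sub_pos.2 (lt_of_le_of_ne (not_lt.1 h') hn₂.symm)))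
    · exact hn (mul_neg_of_pos_of_neg (sub_pos.2 (lt_of_le_of_ne (not_lt.1 h') hn₁.symm))
        (by linarith))
  have := diagramLT_isStrictTotalOrder f x₁ x₂ h₁ h₂ hsame
  let : LinearOrder V := linearOrderOfSTO (diagramLT f x₁ x₂)
  have hlt : ∀ u v : V, u < v ↔ diagramLT f x₁ x₂ u v := fun _ _ => Iff.rfl
  have hle : ∀ u v : V, f u = f v → u ≤ v → x₁ u ≤ x₁ v ∧ x₂ u ≤ x₂ v := by
    intro u v huv h
    rcases h.eq_or_lt with rfl | h
    · exact ⟨le_rfl, le_rfl⟩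
    · rw [hlt, diagramLT, if_neg (by grind)] at h
      exact ⟨h.1.le, h.2.le⟩
  obtain ⟨ψ, hψ, hT⟩ := exists_unit_representation
    (fun x y : V => ∃ a b, f a = false ∧ f b = true ∧ x ≤ a ∧ b ≤ y ∧ x₁ a < x₁ b ∧ x₂ a < x₂ b)
    (fun x y ⟨a, b, ha, hb, hxa, hby, h, _⟩ => hxa.trans_lt <| lt_of_lt_of_le
      ((hlt a b).2 (by rw [diagramLT, if_pos ⟨ha, hb⟩]; exact Or.inl h)) hby)
    (fun x x' y y' hx hy ⟨a, b, ha, hb, hxa, hby, h⟩ =>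
      ⟨a, b, ha, hb, hx.trans hxa, hby.trans hy, h⟩)
  refine IsDoubleThreshold.of_unit_window G f hf ψ fun a b ha hb => ?_
  have hne : a ≠ b := by rintro rfl; simp [ha] at hb
  have hlow : ψ a ≤ ψ b ↔ x₁ a < x₁ b ∨ x₂ a < x₂ b := by
    rw [hψ.le_iff_le, hne.le_iff_lt, hlt, diagramLT, if_pos ⟨ha, hb⟩]
  have hhigh : ψ b ≤ ψ a + 1 ↔ ¬ (x₁ a < x₁ b ∧ x₂ a < x₂ b) := by
    constructor
    · intro h h'
      exact h.not_gt ((hT a b).1 ⟨a, b, ha, hb, le_rfl, le_rfl, h'⟩)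
    · intro h
      refine ((hT a b).2 ?_).le
      rintro ⟨a', b', ha', hb', haa, hbb, h₁', h₂'⟩
      have hA := hle a a' (ha.trans ha'.symm) haa
      have hB := hle b' b (hb'.trans hb.symm) hbb
      exact h ⟨by linarith, by linarith⟩
  rw [hadj a b hne, hlow, hhigh, mul_neg_iff, sub_pos, sub_pos, sub_neg, sub_neg]
  have := h₁.ne hne
  have := h₂.ne hne
  grind
end

section
/- A bipartite finite simple graph is a double-threshold graph if and only if it is a permutation graph; that is, the bipartite double-threshold graphs are exactly the bipartite permutation graphs. -/
open Filter Topology in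
theorem eventually_add_mul_pos {a : ℝ} (ha : 0 < a) (b : ℝ) :
    ∀ᶠ δ : ℝ in 𝓝[>] 0, 0 < a + δ * b := by
  have h : Tendsto (fun δ : ℝ => a + δ * b) (𝓝[>] 0) (𝓝 a) := by
    have hc : Continuous fun δ : ℝ => a + δ * b := by fun_prop
    simpa using (hc.tendsto 0).mono_left nhdsWithin_le_nhds
  exact h.eventually (lt_mem_nhds ha)

open Filter Topology in
theorem eventually_add_mul_ne_zero (a : ℝ) {b : ℝ} (hb : b ≠ 0) :
    ∀ᶠ δ : ℝ in 𝓝[>] 0, a + δ * b ≠ 0 := by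
  rcases lt_trichotomy a 0 with ha | rfl | ha
  · filter_upwards [eventually_add_mul_pos (neg_pos.2 ha) (-b)] with δ hδ
    intro h
    linarith
  · filter_upwards [self_mem_nhdsWithin] with δ hδ
    simpa [hb] using (ne_of_gt hδ : δ ≠ 0)
  · filter_upwards [eventually_add_mul_pos ha b] with δ hδ using hδ.ne'

open Filter Topology in
/-- After an infinitesimal widening of the window `[-c, c]`, membership of `d` in it becomes
a strict sign condition. -/
theorem eventually_mul_neg_iff_abs_le {c : ℝ} (hc : 0 ≤ c) (d : ℝ) {j K : ℝ} (hj : |j| < K) :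
    ∀ᶠ δ : ℝ in 𝓝[>] 0,
      ((d + δ * j - (c + δ * K)) * (d + δ * j + (c + δ * K)) < 0 ↔ |d| ≤ c) := by
  obtain ⟨hj₁, hj₂⟩ := abs_lt.1 hj
  by_cases hd : |d| ≤ c
  · obtain ⟨hd₁, hd₂⟩ := abs_le.1 hd
    filter_upwards [self_mem_nhdsWithin] with δ (hδ : 0 < δ)
    have h₁ : 0 < δ * (K - j) := mul_pos hδ (by linarith)
    have h₂ : 0 < δ * (K + j) := mul_pos hδ (by linarith)
    exact iff_of_true (mul_neg_of_neg_of_pos (by linarith) (by linarith)) hd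
  · rcases lt_abs.1 (not_le.1 hd) with h | h
    · filter_upwards [eventually_add_mul_pos (sub_pos.2 h) (j - K),
        eventually_add_mul_pos (show 0 < d + c by linarith) (j + K)] with δ h₁ h₂
      refine iff_of_false (not_lt.2 (mul_nonneg ?_ ?_)) hd <;> linarith
    · filter_upwards [eventually_add_mul_pos (show 0 < -(d - c) by linarith) (-(j - K)),
        eventually_add_mul_pos (show 0 < -(d + c) by linarith) (-(j + K))] with δ h₁ h₂
      refine iff_of_false (not_lt.2 (mul_nonneg_of_nonpos_of_nonpos ?_ ?_)) hd <;> linarith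

open Filter Topology in
/-- A graph whose edges join the vertices of different classes at distance at most `c` on the
real line is a permutation graph. -/
theorem isPermutationGraph_of_adj_iff_abs_sub_le {V : Type*} [Fintype V] {G : SimpleGraph V}
    {f : V → Bool} {p : V → ℝ} {c : ℝ} (hc : 0 ≤ c)
    (h : ∀ u v, G.Adj u v ↔ f u ≠ f v ∧ |p u - p v| ≤ c) : IsPermutationGraph G := by
  let e : V → ℝ := fun v => (Fintype.equivFin V v : ℕ)
  let K : ℝ := Fintype.card V
  have he : ∀ u v, u ≠ v → e u - e v ≠ 0 := by
    intro u v huv h0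
    apply huv
    have : ((Fintype.equivFin V u : ℕ) : ℝ) = (Fintype.equivFin V v : ℕ) := sub_eq_zero.1 h0
    exact (Fintype.equivFin V).injective (Fin.ext (by exact_mod_cast this))
  have heK : ∀ u v, |e u - e v| < K := by
    have h0 : ∀ v, 0 ≤ e v := fun v => Nat.cast_nonneg _
    have h1 : ∀ v, e v < K := fun v => Nat.cast_lt.2 (Fintype.equivFin V v).2
    intro u v
    rw [abs_lt]
    constructor <;> linarith [h0 u, h0 v, h1 u, h1 v]
  let s : V → ℝ := fun v => if f v then 1 else 0
  have key : ∀ u v, ∀ᶠ δ : ℝ in 𝓝[>] 0, u ≠ v →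
      (p u - p v) + δ * (e u - e v) + (s u - s v) * (c + δ * K) ≠ 0 ∧
      (p u - p v) + δ * (e u - e v) - (s u - s v) * (c + δ * K) ≠ 0 ∧
      (G.Adj u v ↔ ((p u - p v) + δ * (e u - e v) + (s u - s v) * (c + δ * K)) *
        ((p u - p v) + δ * (e u - e v) - (s u - s v) * (c + δ * K)) < 0) := by
    intro u v
    by_cases huv : u = v
    · simp [huv]
    obtain ⟨hK₁, hK₂⟩ := abs_lt.1 (heK u v)
    by_cases hf : f u = f v
    · have hs : s u - s v = 0 := by simp [s, hf]
      filter_upwards [eventually_add_mul_ne_zero (p u - p v) (he u v huv)] with δ hδ _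
      simp only [hs, zero_mul, add_zero, sub_zero]
      exact ⟨hδ, hδ, iff_of_false (fun ha => ((h u v).1 ha).1 hf)
        (not_lt.2 (mul_self_nonneg _))⟩
    · have hs : s u - s v = 1 ∨ s u - s v = -1 := by
        cases hu : f u <;> cases hv : f v <;> simp_all [s]
      filter_upwards [
        eventually_add_mul_ne_zero (p u - p v + c) (show e u - e v + K ≠ 0 by linarith),
        eventually_add_mul_ne_zero (p u - p v - c) (show e u - e v - K ≠ 0 by linarith),
        eventually_mul_neg_iff_abs_le hc (p u - p v) (heK u v)] with δ h₁ h₂ h₃ _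
      have h₁' : p u - p v + δ * (e u - e v) + (c + δ * K) ≠ 0 := fun h0 => h₁ (by linarith)
      have h₂' : p u - p v + δ * (e u - e v) - (c + δ * K) ≠ 0 := fun h0 => h₂ (by linarith)
      rw [h u v, ← h₃]
      rcases hs with hs | hs <;> rw [hs]
      · rw [one_mul]
        exact ⟨h₁', h₂', by rw [mul_comm]; simp [hf]⟩
      · rw [neg_one_mul, sub_neg_eq_add, ← sub_eq_add_neg]
        exact ⟨h₂', h₁', by simp [hf]⟩
  obtain ⟨δ, hδ⟩ := (eventually_all.2 fun u => eventually_all.2 (key u)).exists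
  have e₁ : ∀ u v, (p u + δ * e u + s u * (c + δ * K)) - (p v + δ * e v + s v * (c + δ * K)) =
      (p u - p v) + δ * (e u - e v) + (s u - s v) * (c + δ * K) := fun u v => by ring
  have e₂ : ∀ u v, (p u + δ * e u - s u * (c + δ * K)) - (p v + δ * e v - s v * (c + δ * K)) =
      (p u - p v) + δ * (e u - e v) - (s u - s v) * (c + δ * K) := fun u v => by ring
  refine ⟨fun v => p v + δ * e v + s v * (c + δ * K), fun v => p v + δ * e v - s v * (c + δ * K),
    ?_, ?_, ?_⟩
  · intro u v huv
    by_contra hne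
    exact (hδ u v hne).1 (by rw [← e₁]; exact sub_eq_zero.2 huv)
  · intro u v huv
    by_contra hne
    exact (hδ u v hne).2.1 (by rw [← e₂]; exact sub_eq_zero.2 huv)
  · intro u v huv
    rw [e₁, e₂]
    exact (hδ u v huv).2.2

theorem IsDoubleThreshold.isPermutationGraph {V : Type*} [Fintype V] {G : SimpleGraph V}
    (hbip : IsBipartiteGraph G) (hG : IsDoubleThreshold G) : IsPermutationGraph G := by
  obtain ⟨f, hf⟩ := hbip
  obtain ⟨w, lb, ub, h⟩ := hG
  by_cases hc : lb ≤ ub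
  · let p : V → ℝ := fun v => if f v then w v - (lb + ub) / 4 else -(w v - (lb + ub) / 4)
    refine isPermutationGraph_of_adj_iff_abs_sub_le (f := f) (p := p)
      (show 0 ≤ (ub - lb) / 2 by linarith) fun u v => ?_
    by_cases hfuv : f u = f v
    · exact iff_of_false (fun ha => hf u v ha hfuv) fun ha => ha.1 hfuv
    rw [h u v fun huv => hfuv (congrArg f huv), abs_le]
    cases hu : f u <;> cases hv : f v <;> simp_all [p] <;> constructor <;>
      rintro ⟨_, _⟩ <;> constructor <;> linarith
  · have hinj : Function.Injective fun v => ((Fintype.equivFin V v : ℕ) : ℝ) := fun u v huv =>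
      (Fintype.equivFin V).injective (Fin.ext (Nat.cast_injective huv))
    refine ⟨_, _, hinj, hinj, fun u v huv => iff_of_false ?_ (not_lt.2 (mul_self_nonneg _))⟩
    rw [h u v huv]
    exact fun ⟨h₁, h₂⟩ => hc (h₁.trans h₂)

/-- A monotone relation `Far` on a finite linear order is realised by an increasing real
function as having distance more than one. -/
theorem exists_strictMono_far {V : Type*} [LinearOrder V] {Far : V → V → Prop}
    (hmono : ∀ u v u' v', u' ≤ u → Far u v → v ≤ v' → Far u' v') (s : Finset V) :
    ∃ q : V → ℝ, ∀ u ∈ s, ∀ v ∈ s, u < v →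
      q u < q v ∧ (Far u v → q u + 1 < q v) ∧ (¬ Far u v → q v < q u + 1) := by
  classical
  induction s using Finset.induction_on_max with
  | empty => exact ⟨0, by simp⟩
  | insert m s hm ih =>
    obtain ⟨q, hq⟩ := ih
    have hm' : m ∉ s := fun h => lt_irrefl _ (hm m h)
    obtain ⟨r, hr₁, hr₂⟩ := Order.exists_between_finsets
      (s.image q ∪ (s.filter (Far · m)).image (q · + 1))
      ((s.filter (¬ Far · m)).image (q · + 1)) (by
        simp only [Finset.mem_union, Finset.mem_image, Finset.mem_filter]
        rintro _ (⟨u, hu, rfl⟩ | ⟨u, ⟨hu, hum⟩, rfl⟩) _ ⟨v, ⟨hv, hvm⟩, rfl⟩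
        · rcases lt_trichotomy u v with huv | rfl | huv
          · linarith [(hq u hu v hv huv).1]
          · linarith
          · exact (hq v hv u hu huv).2.2 fun hF => hvm (hmono _ _ _ _ le_rfl hF (hm u hu).le)
        · have huv : u < v := by
            by_contra hvu
            exact hvm (hmono _ _ _ _ (not_lt.1 hvu) hum le_rfl)
          linarith [(hq u hu v hv huv).1])
    have hq' : ∀ u ∈ s, Function.update q m r u = q u := fun u hu =>
      Function.update_of_ne (fun h : u = m => hm' (h ▸ hu)) _ _
    refine ⟨Function.update q m r, fun u hu v hv huv => ?_⟩
    rcases Finset.mem_insert.1 hu with rfl | hus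
    · rcases Finset.mem_insert.1 hv with rfl | hvs
      · exact absurd huv (lt_irrefl _)
      · exact absurd huv (hm v hvs).not_gt
    · rw [hq' u hus]
      rcases Finset.mem_insert.1 hv with rfl | hvs
      · rw [Function.update_self]
        refine ⟨hr₁ _ ?_, fun h => hr₁ _ ?_, fun h => hr₂ _ ?_⟩
        · exact Finset.mem_union_left _ (Finset.mem_image_of_mem q hus)
        · exact Finset.mem_union_right _
            (Finset.mem_image.2 ⟨u, Finset.mem_filter.2 ⟨hus, h⟩, rfl⟩)
        · exact Finset.mem_image.2 ⟨u, Finset.mem_filter.2 ⟨hus, h⟩, rfl⟩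
      · rw [hq' v hvs]
        exact hq u hus v hvs huv

/-- A bipartite graph whose complement is transitively oriented by `Q` has a linear extension of
`Q` in which every edge goes from the class `true` to the class `false`. -/
theorem exists_linearOrder_of_transitive_orientation {V : Type*} {G : SimpleGraph V}
    {f : V → Bool} (hf : ∀ u v, G.Adj u v → f u ≠ f v) {Q : V → V → Prop}
    (htrans : ∀ u v w, Q u v → Q v w → Q u w) (hirr : ∀ u, ¬ Q u u)
    (htotal : ∀ u v, u ≠ v → (G.Adj u v ↔ ¬ Q u v ∧ ¬ Q v u)) :
    ∃ _ : LinearOrder V, ∀ u v : V, u < v ↔ Q u v ∨ (G.Adj u v ∧ f u = true ∧ f v = false) := by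
  classical
  let R : V → V → Prop := fun u v => Q u v ∨ (G.Adj u v ∧ f u = true ∧ f v = false)
  have htot : ∀ u v, R u v ∨ u = v ∨ R v u := by
    intro u v
    by_cases huv : u = v
    · exact Or.inr (Or.inl huv)
    have h₁ := htotal u v huv
    have h₂ := hf u v
    have h₃ := G.adj_comm u v
    simp only [R]
    cases hu : f u <;> cases hv : f v <;> simp_all <;> tauto
  have hasymm : ∀ u v, R u v → R v u → False := by
    intro u v h₁ h₂
    have hne : u ≠ v := by
      rintro rfl
      rcases h₁ with h | h
      · exact hirr _ h
      · exact G.loopless.irrefl _ h.1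
    have h₃ := htotal u v hne
    have h₄ := htotal v u hne.symm
    have h₅ := htrans u v u
    have h₆ := hirr u
    simp only [R] at h₁ h₂
    grind
  have hRtrans : ∀ u v w, R u v → R v w → R u w := by
    intro u v w h₁ h₂
    rcases htot u w with h | rfl | h
    · exact h
    · exact (hasymm u v h₁ h₂).elim
    · -- a cyclic triangle has two consecutive arcs in `Q`, or two consecutive edges
      have a : ∀ a b c, Q a b → Q b c → R c a → False := fun a b c h₁ h₂ h₃ =>
        hasymm a c (Or.inl (htrans a b c h₁ h₂)) h₃
      rcases h₁ with h₁ | h₁ <;> rcases h₂ with h₂ | h₂ <;> rcases h with h | h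
      · exact (a u v w h₁ h₂ (Or.inl h)).elim
      · exact (a u v w h₁ h₂ (Or.inr h)).elim
      · exact (a w u v h h₁ (Or.inr h₂)).elim
      · simp_all
      · exact (a v w u h₂ h (Or.inr h₁)).elim
      · simp_all
      · simp_all
      · simp_all
  have : IsStrictTotalOrder V R :=
    { trichotomous := fun u v h₁ h₂ => by
        rcases htot u v with h | h | h
        · exact (h₁ h).elim
        · exact h
        · exact (h₂ h).elim
      irrefl := fun u h => hasymm u u h h
      trans := hRtrans }
  exact ⟨linearOrderOfSTO R, fun u v => Iff.rfl⟩

theorem isDoubleThreshold_of_adj_iff_sub_mem_Icc {V : Type*} [Finite V] {G : SimpleGraph V}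
    {f : V → Bool} (hf : ∀ u v, G.Adj u v → f u ≠ f v) {q : V → ℝ}
    (h : ∀ u v, f u = true → f v = false → (G.Adj u v ↔ 0 ≤ q v - q u ∧ q v - q u ≤ 1)) :
    IsDoubleThreshold G := by
  obtain ⟨M, hM⟩ : ∃ M, ∀ v, |q v| ≤ M := by
    obtain ⟨M, hM⟩ := (Set.finite_range fun v => |q v|).bddAbove
    exact ⟨M, fun v => hM ⟨v, rfl⟩⟩
  refine ⟨fun v => if f v then M + 1 - q v else q v - (M + 1), 0, 1, fun u v _ => ?_⟩
  obtain ⟨hu₁, hu₂⟩ := abs_le.1 (hM u)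
  obtain ⟨hv₁, hv₂⟩ := abs_le.1 (hM v)
  cases hu : f u <;> cases hv : f v <;> simp only [hu, hv, if_true, Bool.false_eq_true, if_false]
  · exact iff_of_false (fun ha => hf u v ha (hu.trans hv.symm)) fun ⟨_, _⟩ => by linarith
  · rw [G.adj_comm, h v u hv hu]
    ring_nf
  · rw [h u v hu hv]
    ring_nf
  · exact iff_of_false (fun ha => hf u v ha (hu.trans hv.symm)) fun ⟨_, _⟩ => by linarith

theorem IsPermutationGraph.isDoubleThreshold {V : Type*} [Fintype V] {G : SimpleGraph V}
    (hbip : IsBipartiteGraph G) (hG : IsPermutationGraph G) : IsDoubleThreshold G := by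
  obtain ⟨f, hf⟩ := hbip
  obtain ⟨x₁, x₂, hx₁, hx₂, h⟩ := hG
  let Q : V → V → Prop := fun u v => x₁ u < x₁ v ∧ x₂ u < x₂ v
  have htrans : ∀ u v w, Q u v → Q v w → Q u w := fun u v w h₁ h₂ =>
    ⟨h₁.1.trans h₂.1, h₁.2.trans h₂.2⟩
  have htotal : ∀ u v, u ≠ v → (G.Adj u v ↔ ¬ Q u v ∧ ¬ Q v u) := by
    intro u v huv
    rw [h u v huv, mul_neg_iff]
    simp only [Q, sub_pos, sub_neg]
    have h₁ := hx₁.ne huv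
    have h₂ := hx₂.ne huv
    grind
  obtain ⟨_, hR⟩ := exists_linearOrder_of_transitive_orientation hf htrans
    (fun u h => lt_irrefl _ h.1) htotal
  have hclass : ∀ u v, f u = f v → u ≤ v → u = v ∨ Q u v := by
    intro u v huv hle
    rcases hle.eq_or_lt with h | h
    · exact Or.inl h
    · rcases (hR u v).1 h with h | h
      · exact Or.inr h
      · exact absurd huv (hf u v h.1)
  let Far : V → V → Prop := fun u v =>
    ∃ x y, f x = true ∧ f y = false ∧ Q x y ∧ u ≤ x ∧ y ≤ v
  have hFar : ∀ u v, f u = true → f v = false → (Far u v ↔ Q u v) := by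
    refine fun u v hu hv => ⟨?_, fun hQ => ⟨u, v, hu, hv, hQ, le_rfl, le_rfl⟩⟩
    rintro ⟨x, y, hx, hy, hQ, hux, hyv⟩
    have h₁ : Q u y := by
      rcases hclass u x (hu.trans hx.symm) hux with rfl | h
      · exact hQ
      · exact htrans _ _ _ h hQ
    rcases hclass y v (hy.trans hv.symm) hyv with rfl | h
    · exact h₁
    · exact htrans _ _ _ h₁ h
  obtain ⟨q, hq⟩ := exists_strictMono_far (Far := Far)
    (fun u v u' v' hu ⟨x, y, hx, hy, hQ, hux, hyv⟩ hv =>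
      ⟨x, y, hx, hy, hQ, hu.trans hux, hyv.trans hv⟩) Finset.univ
  refine isDoubleThreshold_of_adj_iff_sub_mem_Icc hf (q := q) fun u v hu hv => ?_
  have hne : u ≠ v := by
    rintro rfl
    simp [hu] at hv
  constructor
  · intro ha
    obtain ⟨h₁, -, h₂⟩ := hq u (Finset.mem_univ _) v (Finset.mem_univ _)
      ((hR u v).2 (Or.inr ⟨ha, hu, hv⟩))
    have := h₂ fun hF => ((htotal u v hne).1 ha).1 ((hFar u v hu hv).1 hF)
    constructor <;> linarith
  · rintro ⟨h₁, h₂⟩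
    refine (htotal u v hne).2 ⟨fun hQ => ?_, fun hQ => ?_⟩
    · have := (hq u (Finset.mem_univ _) v (Finset.mem_univ _) ((hR u v).2 (Or.inl hQ))).2.1
        ((hFar u v hu hv).2 hQ)
      linarith
    · have := (hq v (Finset.mem_univ _) u (Finset.mem_univ _) ((hR v u).2 (Or.inl hQ))).1
      linarith

/-- A bipartite graph is a double-threshold graph iff it is a permutation graph. -/
theorem bipartite_dtg_iff_permutation {V : Type*} [Fintype V] (G : SimpleGraph V)
    (hbip : IsBipartiteGraph G) :
    IsDoubleThreshold G ↔ IsPermutationGraph G :=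
  ⟨IsDoubleThreshold.isPermutationGraph hbip, IsPermutationGraph.isDoubleThreshold hbip⟩
end

section
/- For every non-bipartite double-threshold graph G = (V,E), there exist a weight function w : V → ℝ and real numbers lb, ub defining G such that the set {v ∈ V : lb/2 ≤ w(v) ≤ ub/2} is a maximal clique of G (a clique not properly contained in any other clique). -/
open Filter Topology in
/-- Every finite double-threshold graph with `lb ≤ ub` has a representation with thresholds `-2`
and `2`, distinct weights, and strict inequalities along edges, without losing mid-weight
vertices. -/
theorem DefinesDTG.exists_injective_strict {V : Type*} [Fintype V] {G : SimpleGraph V}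
    {w : V → ℝ} {lb ub : ℝ} (h : DefinesDTG G w lb ub) (hle : lb ≤ ub) :
    ∃ w' : V → ℝ, DefinesDTG G w' (-2) 2 ∧ Function.Injective w' ∧
      (∀ u v, G.Adj u v → w' u + w' v < 2 ∧ -2 < w' u + w' v) ∧
      ∀ u, lb / 2 ≤ w u → w u ≤ ub / 2 → |w' u| ≤ 1 := by
  classical
  let e : V → ℝ := fun u => ((Fintype.equivFin V u : ℕ) + 3 : ℝ)⁻¹
  have he0 : ∀ u, 0 < e u := fun u => by positivity
  have he1 : ∀ u, e u < 1 / 2 := fun u => by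
    have : (0 : ℝ) ≤ (Fintype.equivFin V u : ℕ) := by positivity
    have h2 : e u = ((Fintype.equivFin V u : ℕ) + 3 : ℝ)⁻¹ := rfl
    rw [h2, one_div]
    exact inv_strictAnti₀ (by norm_num) (by linarith)
  have hei : Function.Injective e := fun u v huv => by
    have h1 := inv_injective huv
    have h2 : ((Fintype.equivFin V u : ℕ) : ℝ) = (Fintype.equivFin V v : ℕ) := by linarith
    exact (Fintype.equivFin V).injective (Fin.ext (by exact_mod_cast h2))
  have hnon : ∀ u v : V, u ≠ v → ∀ᶠ d in 𝓝[>] (0 : ℝ), ¬ G.Adj u v →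
      w u + w v + d * (e u + e v) < lb - d ∨ ub + d < w u + w v + d * (e u + e v) := by
    intro u v huv
    by_cases hA : G.Adj u v
    · exact Eventually.of_forall fun d h' => absurd hA h'
    have hc : w u + w v < lb ∨ ub < w u + w v := by
      by_contra! hc
      exact hA ((h u v huv).2 hc)
    rcases hc with hc | hc
    · have ht : ∀ᶠ d in 𝓝 (0 : ℝ), w u + w v + d * (e u + e v) < lb - d :=
        ContinuousAt.eventually_lt (by fun_prop) (by fun_prop) (by simpa using hc)
      filter_upwards [ht.filter_mono nhdsWithin_le_nhds] with d hd _ using Or.inl hd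
    · have ht : ∀ᶠ d in 𝓝 (0 : ℝ), ub + d < w u + w v + d * (e u + e v) :=
        ContinuousAt.eventually_lt (by fun_prop) (by fun_prop) (by simpa using hc)
      filter_upwards [ht.filter_mono nhdsWithin_le_nhds] with d hd _ using Or.inr hd
  have hinj : ∀ u v : V, u ≠ v → ∀ᶠ d in 𝓝[>] (0 : ℝ), w u + d * e u ≠ w v + d * e v := by
    intro u v huv
    by_cases hc : w u = w v
    · filter_upwards [self_mem_nhdsWithin] with d hd heq
      have hd' : d ≠ 0 := ne_of_gt hd
      exact huv (hei (mul_left_cancel₀ hd' (by linarith)))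
    · have ht : ∀ᶠ d in 𝓝 (0 : ℝ), w u + d * e u ≠ w v + d * e v :=
        ContinuousAt.eventually_ne (g := fun d => w u + d * e u - (w v + d * e v)) (y := 0)
          (by fun_prop) (by simpa [sub_eq_zero] using hc) |>.mono
            fun d hd heq => hd (sub_eq_zero.2 heq)
      exact ht.filter_mono nhdsWithin_le_nhds
  have hall : ∀ᶠ d in 𝓝[>] (0 : ℝ), 0 < d ∧ ∀ u v : V, u ≠ v →
      (¬ G.Adj u v → w u + w v + d * (e u + e v) < lb - d ∨
        ub + d < w u + w v + d * (e u + e v)) ∧ w u + d * e u ≠ w v + d * e v := by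
    refine Eventually.and self_mem_nhdsWithin ?_
    refine eventually_all.2 fun u => eventually_all.2 fun v => ?_
    by_cases huv : u = v
    · exact Eventually.of_forall fun d h' => absurd huv h'
    · filter_upwards [hnon u v huv, hinj u v huv] with d h1 h2 _ using ⟨h1, h2⟩
  obtain ⟨d, hd, hd'⟩ := hall.exists
  have hK : 0 < ub - lb + 2 * d := by linarith
  have hsum : ∀ u v, (w u + d * e u - (lb + ub) / 4) * 4 / (ub - lb + 2 * d) +
      (w v + d * e v - (lb + ub) / 4) * 4 / (ub - lb + 2 * d) =
      (w u + w v + d * (e u + e v) - (lb + ub) / 2) * 4 / (ub - lb + 2 * d) := by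
    intro u v
    ring
  have hstrict : ∀ u v, G.Adj u v →
      w u + w v + d * (e u + e v) < ub + d ∧ lb - d < w u + w v + d * (e u + e v) := by
    intro u v hA
    obtain ⟨h1, h2⟩ := (h u v hA.ne).1 hA
    have := he0 u
    have := he0 v
    have := he1 u
    have := he1 v
    constructor <;> nlinarith
  have hstrict' : ∀ u v, G.Adj u v →
      (w u + w v + d * (e u + e v) - (lb + ub) / 2) * 4 / (ub - lb + 2 * d) < 2 ∧
      -2 < (w u + w v + d * (e u + e v) - (lb + ub) / 2) * 4 / (ub - lb + 2 * d) := by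
    intro u v hA
    obtain ⟨h1, h2⟩ := hstrict u v hA
    rw [div_lt_iff₀ hK, lt_div_iff₀ hK]
    constructor <;> linarith
  refine ⟨fun u => (w u + d * e u - (lb + ub) / 4) * 4 / (ub - lb + 2 * d), ?_, ?_, ?_, ?_⟩
  · intro u v huv
    rw [hsum]
    refine ⟨fun hA => ⟨(hstrict' u v hA).2.le, (hstrict' u v hA).1.le⟩, fun hc => ?_⟩
    by_contra hA
    rw [div_le_iff₀ hK, le_div_iff₀ hK] at hc
    rcases (hd' u v huv).1 hA with h1 | h1 <;> linarith
  · intro u v huv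
    by_contra hne
    have huv' := (div_left_inj' hK.ne').1 huv
    exact (hd' u v hne).2 (by linarith)
  · intro u v hA
    rw [hsum]
    exact hstrict' u v hA
  · intro u h1 h2
    have := he0 u
    have := he1 u
    rw [abs_le, div_le_iff₀ hK, le_div_iff₀ hK]
    constructor <;> nlinarith

/-- A strictly increasing map commuting with translation by `4` that fixes `[-1, s]` and
`[2 - s, 3]` and takes the value `1` at a prescribed point of `(1, 2 - s)`. -/
theorem exists_strictMono_periodic_fixing {s c : ℝ} (hs : -1 ≤ s) (hc : 1 < c)
    (hcs : c < 2 - s) :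
    ∃ F : ℝ → ℝ, StrictMono F ∧ (∀ t, F (t + 4) = F t + 4) ∧
      (∀ t, -1 ≤ t → t ≤ s → F t = t) ∧ (∀ t, 2 - s ≤ t → t ≤ 3 → F t = t) ∧ F c = 1 := by
  obtain ⟨p, hp⟩ : ∃ p, p = (c - 1) / (c - s) := ⟨_, rfl⟩
  obtain ⟨q, hq⟩ : ∃ q, q = (c - 1) / (2 - s - c) := ⟨_, rfl⟩
  have hp0 : 0 < p := hp ▸ div_pos (by linarith) (by linarith)
  have hq0 : 0 < q := hq ▸ div_pos (by linarith) (by linarith)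
  have hp1 : p < 1 := by rw [hp, div_lt_one (by linarith)]; linarith
  have hpc : p * (c - s) = c - 1 := hp ▸ div_mul_cancel₀ _ (by linarith)
  have hqc : q * (2 - s - c) = c - 1 := hq ▸ div_mul_cancel₀ _ (by linarith)
  let B : ℝ → ℝ := fun t => t - max 0 (min (p * (t - s)) (q * (2 - s - t)))
  have hB : StrictMono B := by
    intro x y hxy
    have h1 : max 0 (min (p * (y - s)) (q * (2 - s - y))) ≤
        max 0 (min (p * (x - s)) (q * (2 - s - x))) + p * (y - x) := by
      have hpos : 0 < p * (y - x) := mul_pos hp0 (by linarith)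
      have hpos' : 0 < q * (y - x) := mul_pos hq0 (by linarith)
      refine max_le (by positivity) ?_
      refine le_trans ?_ (add_le_add_left (le_max_right _ _) _)
      rw [← min_add_add_right]
      exact min_le_min (by linarith) (by linarith)
    have h2 : p * (y - x) < y - x := by nlinarith
    change x - _ < y - _
    linarith
  have hBl : ∀ t, t ≤ s → B t = t := by
    intro t ht
    have h1 : p * (t - s) ≤ 0 := mul_nonpos_of_nonneg_of_nonpos hp0.le (by linarith)
    change t - max 0 _ = t
    rw [max_eq_left ((min_le_left _ _).trans h1), sub_zero]
  have hBr : ∀ t, 2 - s ≤ t → B t = t := by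
    intro t ht
    have h1 : q * (2 - s - t) ≤ 0 := mul_nonpos_of_nonneg_of_nonpos hq0.le (by linarith)
    change t - max 0 _ = t
    rw [max_eq_left ((min_le_right _ _).trans h1), sub_zero]
  have hBc : B c = 1 := by
    change c - max 0 (min (p * (c - s)) (q * (2 - s - c))) = 1
    rw [hpc, hqc, min_self, max_eq_right (by linarith)]
    ring
  let n : ℝ → ℤ := fun t => ⌊(t + 1) / 4⌋
  let F : ℝ → ℝ := fun t => B (t - 4 * n t) + 4 * n t
  have hn : ∀ t, -1 ≤ t - 4 * n t ∧ t - 4 * n t < 3 := by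
    intro t
    have h1 : (n t : ℝ) ≤ (t + 1) / 4 := Int.floor_le _
    have h2 : (t + 1) / 4 < n t + 1 := Int.lt_floor_add_one _
    constructor <;> linarith
  have hB1 : B (-1) = -1 := hBl _ hs
  have hB3 : B 3 = 3 := hBr _ (by linarith)
  have hF : ∀ t, -1 ≤ t → t ≤ 3 → F t = B t := by
    intro t h1 h2
    rcases h2.eq_or_lt with rfl | h2
    · have : n 3 = 1 := by simp only [n]; norm_num
      change B (3 - 4 * n 3) + 4 * n 3 = _
      rw [this, hB3]
      norm_num [hB1]
    · have : n t = 0 := Int.floor_eq_iff.2 ⟨by push_cast; linarith, by push_cast; linarith⟩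
      change B (t - 4 * n t) + 4 * n t = _
      rw [this]
      simp
  refine ⟨F, ?_, ?_, ?_, ?_, ?_⟩
  · intro x y hxy
    change B (x - 4 * n x) + 4 * n x < B (y - 4 * n y) + 4 * n y
    have hnn : n x ≤ n y := Int.floor_le_floor (by linarith)
    rcases hnn.eq_or_lt with heq | hlt
    · rw [heq]
      linarith [hB (show x - 4 * n y < y - 4 * n y by linarith)]
    · have h1 : (n x : ℝ) + 1 ≤ n y := by exact_mod_cast hlt
      have h2 := hB (hn x).2
      have h3 := hB.monotone (hn y).1
      linarith
  · intro t
    have : n (t + 4) = n t + 1 := by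
      change ⌊(t + 4 + 1) / 4⌋ = ⌊(t + 1) / 4⌋ + 1
      rw [← Int.floor_add_one]
      congr 1
      ring
    change B (t + 4 - 4 * n (t + 4)) + 4 * n (t + 4) = B (t - 4 * n t) + 4 * n t + 4
    rw [this]
    push_cast
    rw [show t + 4 - 4 * ((n t : ℝ) + 1) = t - 4 * n t by ring]
    ring
  · intro t h1 h2
    rw [hF t h1 (by linarith), hBl t h2]
  · intro t h1 h2
    rw [hF t (by linarith) h2, hBr t h1]
  · rw [hF c (by linarith) (by linarith), hBc]

/-- A vertex of strictly smallest weight above the mid-range can be moved into the mid-range when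
its weight sums with all mid-weights stay strictly below the upper threshold. -/
theorem DefinesDTG.exists_insert_mid {V : Type*} {G : SimpleGraph V} {w : V → ℝ}
    (h : DefinesDTG G w (-2) 2) {v : V} (hv : 1 < w v)
    (hmin : ∀ u, u ≠ v → 1 < w u → w v < w u) {s : ℝ} (hs : -1 ≤ s) (hvs : w v + s < 2)
    (hm : ∀ u, |w u| ≤ 1 → w u ≤ s) :
    ∃ w' : V → ℝ, DefinesDTG G w' (-2) 2 ∧ |w' v| ≤ 1 ∧ ∀ u, |w u| ≤ 1 → |w' u| ≤ 1 := by
  obtain ⟨F, hF, hF4, hFl, hFr, hFv⟩ :=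
    exists_strictMono_periodic_fixing (c := w v) hs hv (by linarith)
  have hF3 : F 3 = 3 := hFr 3 (by linarith) le_rfl
  let W : V → ℝ := fun u =>
    if 1 < w u then F (w u) else if w u < -1 then 2 - F (2 - w u) else w u
  have hWp : ∀ u, 1 < w u → W u = F (w u) := fun u hu => if_pos hu
  have hWn : ∀ u, w u < -1 → W u = 2 - F (2 - w u) := fun u hu => by
    simp only [W]
    rw [if_neg (by linarith), if_pos hu]
  have hWm : ∀ u, |w u| ≤ 1 → W u = w u := fun u hu => by
    have := abs_le.1 hu
    simp only [W]
    rw [if_neg (by linarith), if_neg (by linarith)]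
  have hWp1 : ∀ u, 1 < w u → 1 ≤ W u := fun u hu => by
    rw [hWp u hu, ← hFv]
    by_cases huv : u = v
    · rw [huv]
    · exact hF.monotone (hmin u huv hu).le
  have hWp1' : ∀ u, u ≠ v → 1 < w u → 1 < W u := fun u huv hu => by
    rw [hWp u hu, ← hFv]
    exact hF (hmin u huv hu)
  have hWn1 : ∀ u, w u < -1 → W u < -1 := fun u hu => by
    rw [hWn u hu]
    linarith [hF (show 3 < 2 - w u by linarith)]
  have hcases : ∀ u, 1 < w u ∨ w u < -1 ∨ |w u| ≤ 1 := fun u => by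
    by_contra! hc
    exact hc.2.2.not_ge (abs_le.2 ⟨hc.2.1, hc.1⟩)
  have hpn : ∀ x b, 1 < w x → w b < -1 →
      ((-2 ≤ w x + w b ∧ w x + w b ≤ 2) ↔ (-2 ≤ W x + W b ∧ W x + W b ≤ 2)) := by
    intro x b hx hb
    rw [hWp x hx, hWn b hb]
    refine and_congr ?_ ?_
    · have h1 := hF.le_iff_le (a := 2 - w b) (b := w x + 4)
      rw [hF4] at h1
      constructor
      · intro h2
        linarith [h1.2 (by linarith)]
      · intro h2
        linarith [h1.1 (by linarith)]
    · have h1 := hF.le_iff_le (a := w x) (b := 2 - w b)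
      constructor
      · intro h2
        linarith [h1.2 (by linarith)]
      · intro h2
        linarith [h1.1 (by linarith)]
  have hpm : ∀ x m, 1 < w x → |w m| ≤ 1 →
      ((-2 ≤ w x + w m ∧ w x + w m ≤ 2) ↔ (-2 ≤ W x + W m ∧ W x + W m ≤ 2)) := by
    intro x m hx hmm
    have hx1 := hWp1 x hx
    have hms := hm m hmm
    rw [hWm m hmm]
    obtain ⟨ha, hb⟩ := abs_le.1 hmm
    have h1 := hF.le_iff_le (a := w x) (b := 2 - w m)
    rw [hFr (2 - w m) (by linarith) (by linarith), ← hWp x hx] at h1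
    constructor
    · rintro ⟨-, h2⟩
      exact ⟨by linarith, by linarith [h1.2 (by linarith)]⟩
    · rintro ⟨-, h2⟩
      exact ⟨by linarith, by linarith [h1.1 (by linarith)]⟩
  have hnm : ∀ b m, w b < -1 → |w m| ≤ 1 →
      ((-2 ≤ w b + w m ∧ w b + w m ≤ 2) ↔ (-2 ≤ W b + W m ∧ W b + W m ≤ 2)) := by
    intro b m hb hmm
    have hb1 := hWn1 b hb
    have hms := hm m hmm
    have hWb := hWn b hb
    rw [hWm m hmm]
    obtain ⟨h2, h3⟩ := abs_le.1 hmm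
    have h1 := hF.le_iff_le (a := 2 - w b) (b := w m + 4)
    rw [hF4, hFl (w m) h2 hms] at h1
    constructor
    · rintro ⟨h4, -⟩
      exact ⟨by linarith [h1.2 (by linarith)], by linarith⟩
    · rintro ⟨h4, -⟩
      exact ⟨by linarith [h1.1 (by linarith)], by linarith⟩
  refine ⟨W, ?_, ?_, ?_⟩
  · intro x y hxy
    rw [h x y hxy]
    rcases hcases x with hx | hx | hx <;> rcases hcases y with hy | hy | hy
    · have h1 := hWp1 x hx
      have h2 := hWp1 y hy
      have h3 : 2 < W x + W y := by
        by_cases hxv : x = v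
        · linarith [hWp1' y (fun hyv => hxy (hxv.trans hyv.symm)) hy]
        · linarith [hWp1' x hxv hx]
      constructor <;> rintro ⟨h4, h5⟩ <;> linarith
    · exact hpn x y hx hy
    · exact hpm x y hx hy
    · rw [add_comm (w x), add_comm (W x)]
      exact hpn y x hy hx
    · have h1 := hWn1 x hx
      have h2 := hWn1 y hy
      constructor <;> rintro ⟨h4, h5⟩ <;> linarith
    · exact hnm x y hx hy
    · rw [add_comm (w x), add_comm (W x)]
      exact hpm y x hy hx
    · rw [add_comm (w x), add_comm (W x)]
      exact hnm y x hy hx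
    · rw [hWm x hx, hWm y hy]
  · rw [hWp v hv, hFv, abs_one]
  · intro u hu
    rwa [hWm u hu]

theorem DefinesDTG.neg {V : Type*} {G : SimpleGraph V} {w : V → ℝ}
    (h : DefinesDTG G w (-2) 2) : DefinesDTG G (-w) (-2) 2 := by
  intro u v huv
  rw [h u v huv]
  simp only [Pi.neg_apply]
  constructor <;> rintro ⟨h1, h2⟩ <;> constructor <;> linarith

theorem DefinesDTG.exists_mid {V : Type*} {G : SimpleGraph V} {w : V → ℝ}
    (h : DefinesDTG G w (-2) 2) (hnonbip : ¬ IsBipartiteGraph G) : ∃ u, |w u| ≤ 1 := by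
  classical
  by_contra! hc
  refine hnonbip ⟨fun u => decide (0 < w u), fun u v hA heq => ?_⟩
  obtain ⟨h1, h2⟩ := (h u v hA.ne).1 hA
  have hiff : 0 < w u ↔ 0 < w v := by simpa using heq
  have hu := lt_abs.1 (hc u)
  have hv := lt_abs.1 (hc v)
  by_cases h0 : 0 < w u
  · have h0' := hiff.1 h0
    rcases hu with hu | hu <;> rcases hv with hv | hv <;> linarith
  · have h0' := mt hiff.2 h0
    rcases hu with hu | hu <;> rcases hv with hv | hv <;> linarith

/-- If a vertex above the mid-range is adjacent to every mid-weight vertex, then some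
representation has strictly more mid-weight vertices. -/
theorem DefinesDTG.exists_enlarge_mid {V : Type*} [Fintype V] {G : SimpleGraph V} {w : V → ℝ}
    (h : DefinesDTG G w (-2) 2) (hnonbip : ¬ IsBipartiteGraph G) (hinj : Function.Injective w)
    (hstrict : ∀ u v, G.Adj u v → w u + w v < 2) {x : V} (hx : 1 < w x)
    (hadj : ∀ u, |w u| ≤ 1 → G.Adj x u) :
    ∃ w' : V → ℝ, DefinesDTG G w' (-2) 2 ∧ (∀ u, |w u| ≤ 1 → |w' u| ≤ 1) ∧
      ∃ v, 1 < |w v| ∧ |w' v| ≤ 1 := by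
  obtain ⟨v, hv, hvmin⟩ :=
    (Set.toFinite {u | 1 < w u}).exists_minimalFor w _ ⟨x, hx⟩
  obtain ⟨m, hm, hmmax⟩ :=
    (Set.toFinite {u | |w u| ≤ 1}).exists_maximalFor w _ (h.exists_mid hnonbip)
  have hvle : ∀ u, 1 < w u → w v ≤ w u := fun u hu => by
    by_contra! hlt
    exact hlt.not_ge (hvmin hu hlt.le)
  obtain ⟨w', h1, h2, h3⟩ := h.exists_insert_mid (v := v) (s := w m) hv
    (fun u huv hu => lt_of_le_of_ne (hvle u hu) fun heq => huv (hinj heq.symm))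
    (abs_le.1 hm).1
    (by linarith [hstrict x m (hadj m hm), hvle x hx])
    (fun u hu => by
      by_contra! hlt
      exact hlt.not_ge (hmmax hu hlt.le))
  exact ⟨w', h1, h3, v, lt_abs.2 (Or.inl hv), h2⟩

/-- For every non-bipartite double-threshold graph there is a defining triple
`(w, lb, ub)` whose set of mid-weight vertices is a maximal clique. -/
theorem dtg_midweight_maximal_clique {V : Type*} [Fintype V] (G : SimpleGraph V)
    (hnonbip : ¬ IsBipartiteGraph G) (hG : IsDoubleThreshold G) :
    ∃ (w : V → ℝ) (lb ub : ℝ), DefinesDTG G w lb ub ∧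
      G.IsClique {v : V | lb / 2 ≤ w v ∧ w v ≤ ub / 2} ∧
      ∀ S : Set V, G.IsClique S → {v : V | lb / 2 ≤ w v ∧ w v ≤ ub / 2} ⊆ S →
        S = {v : V | lb / 2 ≤ w v ∧ w v ≤ ub / 2} := by
  obtain ⟨w₀, lb, ub, h₀⟩ := hG
  have hle : lb ≤ ub := by
    by_contra! hlt
    refine hnonbip ⟨fun _ => true, fun u v hA => ?_⟩
    obtain ⟨h1, h2⟩ := (h₀ u v hA.ne).1 hA
    linarith
  have hmid : ∀ w : V → ℝ, {v : V | (-2 : ℝ) / 2 ≤ w v ∧ w v ≤ 2 / 2} = {v | |w v| ≤ 1} := by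
    intro w
    ext v
    simp only [Set.mem_ofPred_eq, abs_le]
    norm_num
  obtain ⟨w₁, hw₁, -⟩ := h₀.exists_injective_strict hle
  obtain ⟨M, ⟨w, hw, rfl⟩, hmax⟩ :=
    (Set.toFinite {M : Set V | ∃ w, DefinesDTG G w (-2) 2 ∧ {v | |w v| ≤ 1} = M}).exists_maximal
      ⟨_, w₁, hw₁, rfl⟩
  refine ⟨w, -2, 2, hw, ?_⟩
  rw [hmid]
  refine ⟨?_, ?_⟩
  · intro u hu v hv huv
    have h1 := abs_le.1 (show |w u| ≤ 1 from hu)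
    have h2 := abs_le.1 (show |w v| ≤ 1 from hv)
    exact (hw u v huv).2 ⟨by linarith, by linarith⟩
  · intro S hS hsub
    refine Set.Subset.antisymm (fun x hxS => ?_) hsub
    by_contra hx
    obtain ⟨w', hw', hinj, hstrict, hkeep⟩ := hw.exists_injective_strict (by norm_num)
    have hkeep' : ∀ u, |w u| ≤ 1 → |w' u| ≤ 1 := fun u hu =>
      hkeep u (by linarith [(abs_le.1 hu).1]) (by linarith [(abs_le.1 hu).2])
    have hback : ∀ u, |w' u| ≤ 1 → |w u| ≤ 1 := fun u hu => hmax ⟨w', hw', rfl⟩ hkeep' hu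
    have hx' : 1 < |w' x| := by
      by_contra! hle
      exact hx (hback x hle)
    have hadj : ∀ u, |w' u| ≤ 1 → G.Adj x u := fun u hu =>
      hS hxS (hsub (hback u hu)) fun hxu => hx (hxu ▸ hback u hu)
    obtain ⟨w₂, hw₂, hsub₂, v, hv, hv₂⟩ : ∃ w₂ : V → ℝ, DefinesDTG G w₂ (-2) 2 ∧
        (∀ u, |w' u| ≤ 1 → |w₂ u| ≤ 1) ∧ ∃ v, 1 < |w' v| ∧ |w₂ v| ≤ 1 := by
      rcases lt_abs.1 hx' with hpos | hneg
      · exact hw'.exists_enlarge_mid hnonbip hinj (fun u v hA => (hstrict u v hA).1) hpos hadj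
      · have := hw'.neg.exists_enlarge_mid hnonbip (neg_injective.comp hinj)
          (fun u v hA => by
            simp only [Pi.neg_apply]
            linarith [(hstrict u v hA).2]) hneg
          (fun u hu => hadj u (by simpa using hu))
        simpa using this
    have hvw : |w v| ≤ 1 := hmax ⟨w₂, hw₂, rfl⟩ (fun u hu => hsub₂ u (hkeep' u hu)) hv₂
    exact hv.not_ge (hkeep' v hvw)
end

section
/- Let G = (V,E) be a non-bipartite double-threshold graph. For every efficient maximum clique K of G, there exist a weight function w : V → ℝ and real numbers lb, ub defining G such that K = {v ∈ V : lb/2 ≤ w(v) ≤ ub/2}. -/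
/-- An efficient maximum clique: a clique of maximum cardinality minimizing the degree
sum among all maximum cliques. -/
def IsEffMaxClique {V : Type*} [Fintype V] [DecidableEq V] (G : SimpleGraph V)
    [DecidableRel G.Adj] (K : Finset V) : Prop :=
  G.IsClique (K : Set V) ∧
  (∀ K' : Finset V, G.IsClique (K' : Set V) → K'.card ≤ K.card) ∧
  (∀ K' : Finset V, G.IsClique (K' : Set V) → K'.card = K.card →
    ∑ v ∈ K, G.degree v ≤ ∑ v ∈ K', G.degree v)

/-- A normalised weight function: adjacent pairs have weight sum strictly inside `[-1, 1]` and
non-adjacent pairs have weight sum outside. -/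
def StrictlyDefines {V : Type*} (G : SimpleGraph V) (w : V → ℝ) : Prop :=
  ∀ u v : V, u ≠ v →
    (G.Adj u v → |w u + w v| < 1) ∧ (¬ G.Adj u v → 1 < |w u + w v|)

namespace StrictlyDefines

variable {V : Type*} {G : SimpleGraph V} {w : V → ℝ}

theorem definesDTG (h : StrictlyDefines G w) : DefinesDTG G w (-1) 1 := by
  intro u v huv
  rw [← abs_le]
  refine ⟨fun hadj => ((h u v huv).1 hadj).le, fun hle => ?_⟩
  by_contra hadj
  exact absurd ((h u v huv).2 hadj) (not_lt.2 hle)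

theorem lt_of_adj (h : StrictlyDefines G w) {u v : V} (hadj : G.Adj u v) :
    -1 < w u + w v ∧ w u + w v < 1 :=
  abs_lt.1 ((h u v hadj.ne).1 hadj)

theorem adj_of_le (h : StrictlyDefines G w) {u v : V} (huv : u ≠ v)
    (h1 : -1 ≤ w u + w v) (h2 : w u + w v ≤ 1) : G.Adj u v :=
  (h.definesDTG u v huv).2 ⟨h1, h2⟩

theorem neg (h : StrictlyDefines G w) : StrictlyDefines G (fun v => -w v) := by
  intro u v huv
  have : |(-w u) + (-w v)| = |w u + w v| := by rw [← abs_neg]; congr 1; ring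
  simpa only [this] using h u v huv

theorem comp_swap [DecidableEq V] (h : StrictlyDefines G w) {a z : V}
    (haz : ∀ y, G.Adj z y ↔ G.Adj a y) : StrictlyDefines G (w ∘ Equiv.swap a z) := by
  have hfix : ∀ u y, G.Adj (Equiv.swap a z u) y ↔ G.Adj u y := by
    intro u y
    by_cases hua : u = a
    · subst hua; simpa using haz y
    · by_cases huz : u = z
      · subst huz; simpa using (haz y).symm
      · rw [Equiv.swap_apply_of_ne_of_ne hua huz]
  intro u v huv
  have key := h (Equiv.swap a z u) (Equiv.swap a z v) (fun e => huv ((Equiv.swap a z).injective e))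
  rw [hfix, G.adj_comm, hfix, G.adj_comm] at key
  exact key

/-- Vertices of weight between `-1/2` and `1/2` form a clique. -/
theorem isClique_of_abs_le (h : StrictlyDefines G w) {S : Set V}
    (hS : ∀ v ∈ S, -(1 / 2) ≤ w v ∧ w v ≤ 1 / 2) : G.IsClique S := by
  intro u hu v hv huv
  have := hS u hu
  have := hS v hv
  exact h.adj_of_le huv (by linarith) (by linarith)

end StrictlyDefines

/-- A double-threshold graph with an edge has a normalised weight function. -/
theorem DefinesDTG.exists_strictlyDefines {V : Type*} [Finite V] {G : SimpleGraph V} {w : V → ℝ}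
    {lb ub : ℝ} (h : DefinesDTG G w lb ub) {x y : V} (hxy : G.Adj x y) :
    ∃ w' : V → ℝ, StrictlyDefines G w' := by
  have hle : lb ≤ ub := ((h x y hxy.ne).1 hxy).1.trans ((h x y hxy.ne).1 hxy).2
  obtain ⟨r, hr, hnon⟩ : ∃ r, (ub - lb) / 2 < r ∧
      ∀ p : V × V, p.1 ≠ p.2 → ¬ G.Adj p.1 p.2 → r < |w p.1 + w p.2 - (lb + ub) / 2| := by
    have hev : ∀ᶠ r in nhdsWithin ((ub - lb) / 2) (Set.Ioi ((ub - lb) / 2)),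
        ∀ p : V × V, p.1 ≠ p.2 → ¬ G.Adj p.1 p.2 → r < |w p.1 + w p.2 - (lb + ub) / 2| := by
      rw [Filter.eventually_all]
      intro p
      by_cases hp : p.1 ≠ p.2 ∧ ¬ G.Adj p.1 p.2
      · have hlt : (ub - lb) / 2 < |w p.1 + w p.2 - (lb + ub) / 2| := by
          rw [lt_abs]
          by_contra! hcon
          exact hp.2 ((h _ _ hp.1).2 ⟨by linarith, by linarith⟩)
        filter_upwards [nhdsWithin_le_nhds (Iio_mem_nhds hlt)] with r hr _ _ using hr
      · exact Filter.Eventually.of_forall fun r h1 h2 => absurd ⟨h1, h2⟩ hp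
    obtain ⟨r, hr, hr'⟩ := (hev.and self_mem_nhdsWithin).exists
    exact ⟨r, hr', hr⟩
  have hr0 : 0 < r := by linarith
  refine ⟨fun v => (w v - (lb + ub) / 4) / r, fun u v huv => ?_⟩
  have e : (w u - (lb + ub) / 4) / r + (w v - (lb + ub) / 4) / r =
      (w u + w v - (lb + ub) / 2) / r := by ring
  simp only [e]
  rw [abs_div, abs_of_pos hr0, div_lt_one hr0, one_lt_div hr0]
  refine ⟨fun hadj => ?_, hnon (u, v) huv⟩
  have := (h u v huv).1 hadj
  rw [abs_lt]
  constructor <;> linarith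

/-- A triangle-free double-threshold graph is bipartite. -/
theorem StrictlyDefines.exists_isClique_card_three {V : Type*} [DecidableEq V]
    {G : SimpleGraph V} {w : V → ℝ} (h : StrictlyDefines G w) (hG : ¬ IsBipartiteGraph G) :
    ∃ T : Finset V, G.IsClique (T : Set V) ∧ T.card = 3 := by
  by_contra hT
  have htri : ∀ u v x, G.Adj u v → G.Adj u x → G.Adj v x → False := fun u v x huv hux hvx => by
    refine hT ⟨{u, v, x}, ?_, Finset.card_eq_three.2 ⟨u, v, x, huv.ne, hux.ne, hvx.ne, rfl⟩⟩
    exact (SimpleGraph.is3Clique_triple_iff.2 ⟨huv, hux, hvx⟩).isClique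
  apply hG
  by_cases hM : ∃ m₁ m₂, m₁ ≠ m₂ ∧ w m₁ ≤ w m₂ ∧ -(1 / 2) ≤ w m₁ ∧ w m₂ ≤ 1 / 2
  · obtain ⟨m₁, m₂, hne, hle, hlo, hhi⟩ := hM
    have hadj : G.Adj m₁ m₂ := h.adj_of_le hne (by linarith) (by linarith)
    have hpart : ∀ v, v ≠ m₁ → v ≠ m₂ → 1 / 2 < w v ∨ w v < -(1 / 2) := by
      intro v h1 h2
      by_contra! hv
      exact htri m₁ m₂ v hadj (h.adj_of_le h1.symm (by linarith) (by linarith))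
        (h.adj_of_le h2.symm (by linarith) (by linarith))
    have hm₁ : ∀ v, G.Adj v m₁ → w v < -(1 / 2) → False := by
      intro v hv hlt
      have := h.lt_of_adj hv
      have hvne : v ≠ m₂ := by rintro rfl; linarith
      exact htri v m₁ m₂ hv (h.adj_of_le hvne (by linarith) (by linarith)) hadj
    have hm₂ : ∀ v, G.Adj v m₂ → 1 / 2 < w v → False := by
      intro v hv hlt
      have := h.lt_of_adj hv
      have hvne : v ≠ m₁ := by rintro rfl; linarith
      exact htri v m₁ m₂ (h.adj_of_le hvne (by linarith) (by linarith)) hv hadj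
    refine ⟨fun v => decide (v = m₂ ∨ (v ≠ m₁ ∧ 1 / 2 < w v)), ?_⟩
    intro u v huv
    have hb := h.lt_of_adj huv
    have hu := hpart u
    have hv := hpart v
    have hne := huv.ne
    simp only [ne_eq, decide_eq_decide]
    by_cases hu₁ : u = m₁
    · subst hu₁
      have := hm₁ v huv.symm
      clear htri hm₁ hm₂ hpart hT
      grind
    by_cases hu₂ : u = m₂
    · subst hu₂
      have := hm₂ v huv.symm
      clear htri hm₁ hm₂ hpart hT
      grind
    by_cases hv₁ : v = m₁
    · subst hv₁
      have := hm₁ u huv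
      clear htri hm₁ hm₂ hpart hT
      grind
    by_cases hv₂ : v = m₂
    · subst hv₂
      have := hm₂ u huv
      clear htri hm₁ hm₂ hpart hT
      grind
    rcases hu hu₁ hu₂ with hu | hu <;> rcases hv hv₁ hv₂ with hv | hv
    · linarith
    · simp only [hu₁, hu₂, hv₁, hv₂, hu, (show ¬ 1 / 2 < w v by linarith)]
      simp
    · simp only [hu₁, hu₂, hv₁, hv₂, hv, (show ¬ 1 / 2 < w u by linarith)]
      simp
    · linarith
  · push Not at hM
    have huniq : ∀ u v, u ≠ v → -(1 / 2) ≤ w u → w u ≤ 1 / 2 → -(1 / 2) ≤ w v → 1 / 2 < w v := by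
      intro u v huv h1 h2 h3
      rcases le_total (w u) (w v) with hle | hle
      · exact hM u v huv hle h1
      · have := hM v u huv.symm hle h3
        linarith
    have hside : ∀ m a b, -(1 / 2) ≤ w m → w m ≤ 1 / 2 → G.Adj m a → 1 / 2 < w a → G.Adj m b →
        w b < -(1 / 2) → False := by
      intro m a b h1 h2 hma ha hmb hb
      have := h.lt_of_adj hma
      have := h.lt_of_adj hmb
      have hab : a ≠ b := by rintro rfl; linarith
      exact htri m a b hma hmb (h.adj_of_le hab (by linarith) (by linarith))
    classical
    refine ⟨fun v => decide (1 / 2 < w v ∨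
      (-(1 / 2) ≤ w v ∧ ∃ b, G.Adj v b ∧ w b < -(1 / 2))), ?_⟩
    have hwlog : ∀ u v, G.Adj u v → w u ≤ w v →
        ¬ ((1 / 2 < w u ∨ (-(1 / 2) ≤ w u ∧ ∃ b, G.Adj u b ∧ w b < -(1 / 2))) ↔
          (1 / 2 < w v ∨ (-(1 / 2) ≤ w v ∧ ∃ b, G.Adj v b ∧ w b < -(1 / 2)))) := by
      intro u v huv hle hiff
      have hb := h.lt_of_adj huv
      have hu : w u ≤ 1 / 2 := by linarith
      rcases lt_or_ge (w u) (-(1 / 2)) with hu' | hu'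
      · have hv : -(1 / 2) ≤ w v := by linarith
        rcases hiff.2 (Or.inr ⟨hv, u, huv.symm, hu'⟩) with h1 | h1
        · linarith
        · linarith [h1.1]
      · have hv := huniq u v huv.ne hu' hu (by linarith)
        rcases hiff.2 (Or.inl hv) with h1 | ⟨-, b, hub, hb'⟩
        · linarith
        · exact hside u v b hu' hu huv hv hub hb'
    intro u v huv
    simp only [ne_eq, decide_eq_decide]
    rcases le_total (w u) (w v) with hle | hle
    · exact hwlog u v huv hle
    · exact fun e => hwlog v u huv.symm hle e.symm

/-- A `2`-periodic displacement of the line that pushes the points at distance less than `d` from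
`1/2 + 2 * k` to the left of `1/2 + 2 * k`. -/
noncomputable def pushLeft (d x : ℝ) : ℝ :=
  let c : ℝ := 1 / 2 + 2 * ⌊(x + 1 / 2) / 2⌋
  if |x - c| < d then (x + c - d) / 2 else x

theorem pushLeft_add_two (d x : ℝ) : pushLeft d (x + 2) = pushLeft d x + 2 := by
  have e : ⌊(x + 2 + 1 / 2) / 2⌋ = ⌊(x + 1 / 2) / 2⌋ + 1 := by
    rw [← Int.floor_add_one]; congr 1; ring
  unfold pushLeft
  simp only [e]
  push_cast
  have e' : x + 2 - (1 / 2 + 2 * ((⌊(x + 1 / 2) / 2⌋ : ℝ) + 1)) =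
      x - (1 / 2 + 2 * (⌊(x + 1 / 2) / 2⌋ : ℝ)) := by ring
  rw [e']
  split_ifs <;> ring

theorem pushLeft_of_mem {d x : ℝ} (h1 : -(1 / 2) ≤ x) (h2 : x < 3 / 2) :
    pushLeft d x = if |x - 1 / 2| < d then (x + 1 / 2 - d) / 2 else x := by
  have e : ⌊(x + 1 / 2) / 2⌋ = 0 := by
    rw [Int.floor_eq_iff]; constructor <;> push_cast <;> linarith
  simp only [pushLeft, e, Int.cast_zero, mul_zero, add_zero]

theorem pushLeft_strictMono {d : ℝ} (h0 : 0 < d) (h1 : d < 1) : StrictMono (pushLeft d) := by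
  intro x y hxy
  have hx := Int.floor_le ((x + 1 / 2) / 2)
  have hx' := Int.lt_floor_add_one ((x + 1 / 2) / 2)
  have hy := Int.floor_le ((y + 1 / 2) / 2)
  have hmono : ⌊(x + 1 / 2) / 2⌋ ≤ ⌊(y + 1 / 2) / 2⌋ := Int.floor_mono (by linarith)
  unfold pushLeft
  generalize ⌊(x + 1 / 2) / 2⌋ = k at *
  generalize ⌊(y + 1 / 2) / 2⌋ = l at *
  simp only [abs_lt]
  rcases hmono.eq_or_lt with rfl | hlt
  · split_ifs with ha hb hb
    · linarith
    · rw [not_and_or, not_lt, not_lt] at hb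
      rcases hb with hb | hb <;> linarith
    · rw [not_and_or, not_lt, not_lt] at ha
      rcases ha with ha | ha <;> linarith
    · exact hxy
  · have hkl : (k : ℝ) + 1 ≤ l := by exact_mod_cast hlt
    split_ifs with ha hb hb <;> linarith

/-- The map that agrees with `pushLeft d` to the right of `-1/2` and commutes with the reflection
in `-1/2`. -/
noncomputable def pushCenter (d x : ℝ) : ℝ :=
  if -(1 / 2) ≤ x then pushLeft d x else -1 - pushLeft d (-1 - x)

theorem pushLeft_neg_half {d : ℝ} (h1 : d < 1) : pushLeft d (-(1 / 2)) = -(1 / 2) := by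
  rw [pushLeft_of_mem (by norm_num) (by norm_num), if_neg]
  rw [not_lt, abs_of_neg] <;> linarith

theorem pushCenter_of_mem {d x : ℝ} (h1 : -(1 / 2) ≤ x) (h2 : x < 3 / 2) :
    pushCenter d x = if |x - 1 / 2| < d then (x + 1 / 2 - d) / 2 else x := by
  rw [pushCenter, if_pos h1, pushLeft_of_mem h1 h2]

theorem pushCenter_strictMono {d : ℝ} (h0 : 0 < d) (h1 : d < 1) : StrictMono (pushCenter d) := by
  intro x y hxy
  have hm := pushLeft_strictMono h0 h1
  have hc := pushLeft_neg_half h1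
  unfold pushCenter
  split_ifs with ha hb hb
  · exact hm hxy
  · linarith
  · have h2 : pushLeft d (-(1 / 2)) < pushLeft d (-1 - x) := hm (by linarith)
    have h3 : pushLeft d (-(1 / 2)) ≤ pushLeft d y := hm.monotone hb
    linarith
  · have h2 : pushLeft d (-1 - y) < pushLeft d (-1 - x) := hm (by linarith)
    linarith

theorem pushCenter_neg_one_sub {d : ℝ} (h1 : d < 1) (x : ℝ) :
    pushCenter d (-1 - x) = -1 - pushCenter d x := by
  have hc := pushLeft_neg_half h1
  unfold pushCenter
  split_ifs with ha hb hb
  · have : x = -(1 / 2) := by linarith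
    subst this
    norm_num at hc ⊢
    linarith
  · ring
  · rw [sub_sub_cancel]
  · linarith

theorem pushCenter_one_sub {d : ℝ} (h1 : d < 1) {x : ℝ} (hx : d ≤ |x - 1 / 2|) :
    pushCenter d (1 - x) = 1 - pushCenter d x := by
  have key : ∀ y, 3 / 2 ≤ y → pushCenter d (1 - y) = 1 - pushCenter d y := by
    intro y hy
    have e1 : (1 : ℝ) - y = -1 - (y - 2) := by ring
    have e2 : pushLeft d y = pushLeft d (y - 2) + 2 := by
      rw [← pushLeft_add_two, sub_add_cancel]
    rw [e1, pushCenter_neg_one_sub h1]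
    unfold pushCenter
    rw [if_pos (by linarith), if_pos (by linarith), e2]
    ring
  rcases le_or_gt (3 / 2) x with h | h
  · exact key x h
  rcases le_or_gt x (-(1 / 2)) with h' | h'
  · have := key (1 - x) (by linarith)
    rw [sub_sub_cancel] at this
    linarith
  · have hx' : d ≤ |1 - x - 1 / 2| := by
      rw [← abs_neg]; convert hx using 2; ring
    rw [pushCenter_of_mem (by linarith) (by linarith), pushCenter_of_mem h'.le h,
      if_neg hx'.not_gt, if_neg hx.not_gt]

/-- If no weight lies in `[1 - w a, w a)`, the vertex `a` can be given weight `1/2`. -/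
theorem StrictlyDefines.exists_eq_half {V : Type*} {G : SimpleGraph V} {w : V → ℝ}
    (h : StrictlyDefines G w) {a : V} (ha : 1 / 2 < w a) (ha' : w a < 3 / 2)
    (hgap : ∀ v, v ≠ a → w a ≤ w v ∨ w v < 1 - w a) :
    ∃ w' : V → ℝ, StrictlyDefines G w' ∧ w' a = 1 / 2 ∧
      ∀ v, -(1 / 2) ≤ w v → w v ≤ 1 / 2 → w' v = w v := by
  classical
  obtain ⟨d, hd⟩ : ∃ d, w a = 1 / 2 + d := ⟨w a - 1 / 2, by ring⟩
  have hd0 : 0 < d := by linarith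
  have hd1 : d < 1 := by linarith
  set f := pushCenter d with hf
  have hmono : StrictMono f := pushCenter_strictMono hd0 hd1
  have hout : ∀ v, v ≠ a → d ≤ |w v - 1 / 2| := by
    intro v hv
    rw [le_abs]
    rcases hgap v hv with h1 | h1
    · left; linarith
    · right; linarith
  have hright : f (1 / 2 + d) = 1 / 2 + d := by
    rw [hf, pushCenter_of_mem (by linarith) (by linarith), if_neg]
    rw [add_sub_cancel_left, abs_of_pos hd0]; exact lt_irrefl d
  have hleft : f (1 / 2 - d) = 1 / 2 - d := by
    rw [hf, pushCenter_of_mem (by linarith) (by linarith), if_neg]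
    rw [not_lt, le_abs]; right; linarith
  have hfar : f (-3 / 2 - d) = -3 / 2 - d := by
    have := pushCenter_neg_one_sub hd1 (1 / 2 + d)
    rw [← hf, hright] at this
    convert this using 1
    · congr 1; ring
    · ring
  have hnear : ∀ x, -3 / 2 - d < x → -3 / 2 < f x := by
    intro x hx
    rcases le_or_gt (-(1 / 2)) x with h1 | h1
    · have h2 : f (-(1 / 2)) ≤ f x := hmono.monotone h1
      have h3 : f (-(1 / 2)) = -(1 / 2) := by
        rw [hf, pushCenter, if_pos le_rfl, pushLeft_neg_half hd1]
      linarith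
    · have h2 : f (-1 - x) = -1 - f x := pushCenter_neg_one_sub hd1 x
      have h3 : f (-1 - x) < 1 / 2 := by
        rw [hf, pushCenter_of_mem (by linarith) (by linarith)]
        split_ifs with h4
        · linarith
        · rw [not_lt, le_abs] at h4
          rcases h4 with h4 | h4 <;> linarith
      linarith
  have hapair : ∀ v, v ≠ a →
      (G.Adj a v → |1 / 2 + f (w v)| < 1) ∧ (¬ G.Adj a v → 1 < |1 / 2 + f (w v)|) := by
    intro v hv
    constructor
    · intro hadj
      have h1 := h.lt_of_adj hadj
      have h2 := hmono (show w v < 1 / 2 - d by linarith)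
      have h3 := hnear (w v) (by linarith)
      rw [abs_lt]
      constructor <;> linarith
    · intro hadj
      have h1 := (h a v hv.symm).2 hadj
      rw [lt_abs] at h1 ⊢
      rcases h1 with h1 | h1
      · left
        have h2 : w a ≤ w v := (hgap v hv).resolve_right (by linarith)
        have h3 := hmono.monotone (show 1 / 2 + d ≤ w v by linarith)
        linarith
      · right
        have h2 := hmono (show w v < -3 / 2 - d by linarith)
        linarith
  refine ⟨fun v => if v = a then 1 / 2 else f (w v), ?_, by simp, ?_⟩
  · intro u v huv
    by_cases hu : u = a
    · subst hu
      simpa [huv.symm] using hapair v huv.symm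
    by_cases hv : v = a
    · subst hv
      simpa [huv, add_comm, G.adj_comm] using hapair u huv
    simp only [hu, hv, if_false]
    have e1 : f (1 - w v) = 1 - f (w v) := pushCenter_one_sub hd1 (hout v hv)
    have e2 : f (-1 - w v) = -1 - f (w v) := pushCenter_neg_one_sub hd1 _
    constructor
    · intro hadj
      have h1 := h.lt_of_adj hadj
      have h2 := hmono (show w u < 1 - w v by linarith)
      have h3 := hmono (show -1 - w v < w u by linarith)
      rw [abs_lt]
      constructor <;> linarith
    · intro hadj
      have h1 := (h u v huv).2 hadj
      rw [lt_abs] at h1 ⊢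
      rcases h1 with h1 | h1
      · left
        have h2 := hmono (show 1 - w v < w u by linarith)
        linarith
      · right
        have h2 := hmono (show w u < -1 - w v by linarith)
        linarith
  · intro v h1 h2
    have hv : v ≠ a := by rintro rfl; linarith
    simp only [hv, if_false]
    rw [hf, pushCenter_of_mem h1 (by linarith), if_neg (hout v hv).not_gt]

/-- A clique with at least three vertices, one of them of weight above `1/2`, has a vertex of
weight in `[-1/2, 1/2]`. -/
theorem StrictlyDefines.exists_mem_mid {V : Type*} [DecidableEq V] {G : SimpleGraph V}
    {K : Finset V} {w : V → ℝ} (h : StrictlyDefines G w)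
    (hK : G.IsClique (K : Set V)) (hcard : 3 ≤ K.card) {a : V} (ha : a ∈ K) (haw : 1 / 2 < w a) :
    ∃ m ∈ K, -(1 / 2) ≤ w m ∧ w m ≤ 1 / 2 := by
  have h1 : 1 < (K.erase a).card := by
    rw [Finset.card_erase_of_mem ha]; omega
  obtain ⟨x, hx, y, hy, hxy⟩ := Finset.one_lt_card.1 h1
  rw [Finset.mem_erase] at hx hy
  have hax := h.lt_of_adj (hK ha hx.2 hx.1.symm)
  have hay := h.lt_of_adj (hK ha hy.2 hy.1.symm)
  have hxy := h.lt_of_adj (hK hx.2 hy.2 hxy)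
  rcases lt_or_ge (w x) (-(1 / 2)) with hlt | hge
  · exact ⟨y, hy.2, by linarith, by linarith⟩
  · exact ⟨x, hx.2, hge, by linarith⟩

section EfficientClique

variable {V : Type*} [Fintype V] [DecidableEq V] {G : SimpleGraph V} [DecidableRel G.Adj]
  {K : Finset V} {w : V → ℝ}

/-- Replacing a vertex of an efficient maximum clique by another one does not decrease the
degree. -/
theorem IsEffMaxClique.degree_le (hK : IsEffMaxClique G K) {a z : V} (ha : a ∈ K) (hz : z ∉ K)
    (hadj : ∀ k ∈ K, k ≠ a → G.Adj z k) : G.degree a ≤ G.degree z := by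
  have hz' : z ∉ K.erase a := fun hmem => hz (Finset.mem_of_mem_erase hmem)
  have hcl : G.IsClique ((insert z (K.erase a) : Finset V) : Set V) := by
    rw [Finset.coe_insert]
    refine (hK.1.subset (Finset.coe_subset.2 (Finset.erase_subset a K))).insert ?_
    intro k hk _
    rw [Finset.mem_coe, Finset.mem_erase] at hk
    exact hadj k hk.2 hk.1
  have hcard : (insert z (K.erase a)).card = K.card := by
    rw [Finset.card_insert_of_notMem hz', Finset.card_erase_add_one ha]
  have hsum := hK.2.2 _ hcl hcard
  rw [Finset.sum_insert hz', ← Finset.add_sum_erase K _ ha] at hsum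
  exact Nat.le_of_add_le_add_right hsum

/-- Two adjacent vertices cannot both replace the same vertex of a maximum clique. -/
theorem IsEffMaxClique.not_adj (hK : IsEffMaxClique G K) {a y z : V} (ha : a ∈ K)
    (hy : y ∉ K) (hz : z ∉ K) (hyadj : ∀ k ∈ K, k ≠ a → G.Adj y k)
    (hzadj : ∀ k ∈ K, k ≠ a → G.Adj z k) : ¬ G.Adj y z := by
  intro hyz
  have hz' : z ∉ K.erase a := fun hmem => hz (Finset.mem_of_mem_erase hmem)
  have hy' : y ∉ insert z (K.erase a) := by
    rw [Finset.mem_insert, not_or]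
    exact ⟨hyz.ne, fun hmem => hy (Finset.mem_of_mem_erase hmem)⟩
  have hcl : G.IsClique ((insert y (insert z (K.erase a)) : Finset V) : Set V) := by
    rw [Finset.coe_insert, Finset.coe_insert]
    refine ((hK.1.subset (Finset.coe_subset.2 (Finset.erase_subset a K))).insert ?_).insert ?_
    · intro k hk _
      rw [Finset.mem_coe, Finset.mem_erase] at hk
      exact hzadj k hk.2 hk.1
    · intro k hk _
      rw [Set.mem_insert_iff, Finset.mem_coe, Finset.mem_erase] at hk
      rcases hk with rfl | hk
      · exact hyz
      · exact hyadj k hk.2 hk.1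
  have hcard := hK.2.1 _ hcl
  rw [Finset.card_insert_of_notMem hy', Finset.card_insert_of_notMem hz',
    Finset.card_erase_add_one ha] at hcard
  omega

/-- A vertex of weight above `1/2` in an efficient maximum clique can be made mid-weight, keeping
the other mid-weight vertices of the clique mid-weight. -/
theorem StrictlyDefines.exists_mid_of_half_lt (h : StrictlyDefines G w)
    (hK : IsEffMaxClique G K) (hcard : 3 ≤ K.card) {a : V} (ha : a ∈ K) (haw : 1 / 2 < w a) :
    ∃ w' : V → ℝ, StrictlyDefines G w' ∧ |w' a| ≤ 1 / 2 ∧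
      ∀ v ∈ K, |w v| ≤ 1 / 2 → |w' v| ≤ 1 / 2 := by
  obtain ⟨m, hmK, hm1, hm2⟩ := h.exists_mem_mid hK.1 hcard ha haw
  have hma : m ≠ a := by rintro rfl; linarith
  have ham := h.lt_of_adj (hK.1 ha hmK hma.symm)
  have hmz : ∀ z, 1 ≤ w z + w a → w m < w z := fun z hz => by linarith
  have hzK : ∀ z, w z < w a → 1 ≤ w z + w a → z ∉ K := by
    intro z hz1 hz2 hmem
    have hza : z ≠ a := by rintro rfl; exact lt_irrefl _ hz1
    have := h.lt_of_adj (hK.1 hmem ha hza)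
    linarith
  have hzadj : ∀ z, w z < w a → 1 ≤ w z + w a → ∀ k ∈ K, k ≠ a → G.Adj z k := by
    intro z hz1 hz2 k hk hka
    have hzk : z ≠ k := by rintro rfl; exact hzK z hz1 hz2 hk
    have hak := h.lt_of_adj (hK.1 ha hk hka.symm)
    have hz3 := hmz z hz2
    refine h.adj_of_le hzk ?_ (by linarith)
    by_cases hkm : k = m
    · subst hkm; linarith
    · have := h.lt_of_adj (hK.1 hmK hk (Ne.symm hkm))
      linarith
  have htwin : ∀ z, w z < w a → 1 ≤ w z + w a → ∀ y, G.Adj z y ↔ G.Adj a y := by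
    intro z hz1 hz2
    have hsub : G.neighborFinset z ⊆ G.neighborFinset a := by
      intro y hy
      rw [SimpleGraph.mem_neighborFinset] at hy ⊢
      have hzy := h.lt_of_adj hy
      have hya : y ≠ a := by rintro rfl; linarith
      by_contra hay
      have hlt : 1 < w a + w y := by
        rcases lt_abs.1 ((h a y hya.symm).2 hay) with h1 | h1
        · exact h1
        · linarith
      have hy1 : w y < w a := by linarith
      have hy2 : 1 ≤ w y + w a := by linarith
      exact hK.not_adj ha (hzK z hz1 hz2) (hzK y hy1 hy2) (hzadj z hz1 hz2) (hzadj y hy1 hy2) hy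
    have heq := Finset.eq_of_subset_of_card_le hsub
      (hK.degree_le ha (hzK z hz1 hz2) (hzadj z hz1 hz2))
    intro y
    rw [← SimpleGraph.mem_neighborFinset, heq, SimpleGraph.mem_neighborFinset]
  have hreduce : ∃ w₁ : V → ℝ, StrictlyDefines G w₁ ∧ -(1 / 2) ≤ w₁ a ∧ w₁ a < 3 / 2 ∧
      (∀ v, v ≠ a → w₁ a ≤ w₁ v ∨ w₁ v < 1 - w₁ a) ∧ ∀ v ∈ K, v ≠ a → w₁ v = w v := by
    rcases (Finset.univ.filter fun z => w z < w a ∧ 1 ≤ w z + w a).eq_empty_or_nonempty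
      with hZ | hZ
    · refine ⟨w, h, by linarith, by linarith, fun v _ => ?_, fun _ _ _ => rfl⟩
      by_contra! hv
      exact Finset.notMem_empty v (hZ ▸ Finset.mem_filter.2 ⟨Finset.mem_univ v, hv.1, by linarith⟩)
    · obtain ⟨z, hz, hmin⟩ := Finset.exists_min_image _ w hZ
      obtain ⟨-, hz1, hz2⟩ := Finset.mem_filter.1 hz
      have hmin' : ∀ v, w v < w a → 1 ≤ w v + w a → w z ≤ w v := fun v h1 h2 =>
        hmin v (Finset.mem_filter.2 ⟨Finset.mem_univ v, h1, h2⟩)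
      refine ⟨w ∘ Equiv.swap a z, h.comp_swap (htwin z hz1 hz2), ?_, ?_, ?_, ?_⟩
      · rw [Function.comp_apply, Equiv.swap_apply_left]; linarith [hmz z hz2]
      · rw [Function.comp_apply, Equiv.swap_apply_left]; linarith
      · intro v _
        simp only [Function.comp_apply, Equiv.swap_apply_left]
        by_contra! hv
        linarith [hmin' (Equiv.swap a z v) (by linarith) (by linarith)]
      · intro v hv hva
        have hvz : v ≠ z := by rintro rfl; exact hzK v hz1 hz2 hv
        rw [Function.comp_apply, Equiv.swap_apply_of_ne_of_ne hva hvz]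
  obtain ⟨w₁, h₁, hlo, hhi, hgap, hsame⟩ := hreduce
  have hnot : ∀ v, |w v| ≤ 1 / 2 → v ≠ a := by
    rintro v hv rfl
    linarith [(abs_le.1 hv).2]
  rcases le_or_gt (w₁ a) (1 / 2) with hle | hgt
  · refine ⟨w₁, h₁, abs_le.2 ⟨hlo, hle⟩, fun v hv hvm => ?_⟩
    rwa [hsame v hv (hnot v hvm)]
  · obtain ⟨w₂, h₂, hw₂, hmid⟩ := h₁.exists_eq_half hgt hhi hgap
    refine ⟨w₂, h₂, by rw [hw₂, abs_of_pos one_half_pos], fun v hv hvm => ?_⟩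
    have e := hsame v hv (hnot v hvm)
    have hvm' := abs_le.1 hvm
    rw [hmid v (by linarith) (by linarith), e]
    exact hvm

/-- A strictly defining weight function can be chosen with every vertex of an efficient maximum
clique mid-weight. -/
theorem StrictlyDefines.exists_forall_mid (h : StrictlyDefines G w)
    (hK : IsEffMaxClique G K) (hcard : 3 ≤ K.card) :
    ∃ w' : V → ℝ, StrictlyDefines G w' ∧ ∀ v ∈ K, |w' v| ≤ 1 / 2 := by
  induction hn : (K.filter fun v => 1 / 2 < |w v|).card using Nat.strong_induction_on
    generalizing w with
  | _ n ih =>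
    by_cases hall : ∀ v ∈ K, |w v| ≤ 1 / 2
    · exact ⟨w, h, hall⟩
    push Not at hall
    obtain ⟨a, ha, haw⟩ := hall
    obtain ⟨w', h', ha', hkeep⟩ : ∃ w' : V → ℝ, StrictlyDefines G w' ∧ |w' a| ≤ 1 / 2 ∧
        ∀ v ∈ K, |w v| ≤ 1 / 2 → |w' v| ≤ 1 / 2 := by
      rcases lt_abs.1 haw with hpos | hneg
      · exact h.exists_mid_of_half_lt hK hcard ha hpos
      · obtain ⟨w', h', ha', hkeep⟩ := h.neg.exists_mid_of_half_lt hK hcard ha hneg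
        exact ⟨w', h', ha', fun v hv hvm => hkeep v hv (by rwa [abs_neg])⟩
    refine ih _ ?_ h' rfl
    rw [← hn]
    refine Finset.card_lt_card ⟨fun v hv => ?_, fun hsub => ?_⟩
    · rw [Finset.mem_filter] at hv ⊢
      exact ⟨hv.1, not_le.1 fun hle => absurd (hkeep v hv.1 hle) (not_le.2 hv.2)⟩
    · exact absurd (Finset.mem_filter.1 (hsub (Finset.mem_filter.2 ⟨ha, haw⟩))).2 (not_lt.2 ha')

end EfficientClique

/-- For a non-bipartite double-threshold graph, every efficient maximum clique can serve
as the set of mid-weight vertices for some defining triple. -/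
theorem dtg_efficient_max_clique_midweight {V : Type*} [Fintype V] [DecidableEq V]
    (G : SimpleGraph V) [DecidableRel G.Adj]
    (hnonbip : ¬ IsBipartiteGraph G) (hG : IsDoubleThreshold G)
    (K : Finset V) (hK : IsEffMaxClique G K) :
    ∃ (w : V → ℝ) (lb ub : ℝ), DefinesDTG G w lb ub ∧
      (K : Set V) = {v : V | lb / 2 ≤ w v ∧ w v ≤ ub / 2} := by
  obtain ⟨w₀, lb, ub, h₀⟩ := hG
  obtain ⟨x, y, hxy⟩ : ∃ x y, G.Adj x y := by
    by_contra! hno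
    exact hnonbip ⟨fun _ => true, fun u v huv => absurd huv (hno u v)⟩
  obtain ⟨w₁, h₁⟩ := h₀.exists_strictlyDefines hxy
  obtain ⟨T, hT, hT3⟩ := h₁.exists_isClique_card_three hnonbip
  obtain ⟨w, h, hmid⟩ := h₁.exists_forall_mid hK (hT3 ▸ hK.2.1 T hT)
  refine ⟨w, -1, 1, h.definesDTG, ?_⟩
  have hcl : G.IsClique
      ((Finset.univ.filter fun v => -(1 / 2) ≤ w v ∧ w v ≤ 1 / 2 : Finset V) : Set V) :=
    h.isClique_of_abs_le fun v hv => (Finset.mem_filter.1 hv).2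
  have hsub : K ⊆ Finset.univ.filter fun v => -(1 / 2) ≤ w v ∧ w v ≤ 1 / 2 := fun v hv =>
    Finset.mem_filter.2 ⟨Finset.mem_univ v, abs_le.1 (hmid v hv)⟩
  have heq := Finset.eq_of_subset_of_card_le hsub (hK.2.1 _ hcl)
  ext v
  rw [Finset.mem_coe, heq, Finset.mem_filter, Set.mem_ofPred_eq, neg_div]
  simp only [Finset.mem_univ, true_and]
end

section
/- A finite simple graph with at most 5 vertices fails to be a double-threshold graph if and only if it is isomorphic to one of the following four graphs: C₅ (the cycle on 5 vertices), the bull (a triangle abc together with two further vertices d and e where d is adjacent only to a and e is adjacent only to b), the butterfly (two triangles sharing exactly one common vertex), and the gem (a path on 4 vertices together with a fifth vertex adjacent to all four path vertices). -/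
/-- The cycle on five vertices. -/
def cycle5 : SimpleGraph (Fin 5) :=
  SimpleGraph.fromRel (fun i j => ((i : ℕ), (j : ℕ)) ∈ [(0,1),(1,2),(2,3),(3,4),(4,0)])

/-- The bull: a triangle `0 1 2` with pendant vertices `3` (adjacent to `0`) and
`4` (adjacent to `1`). -/
def bull : SimpleGraph (Fin 5) :=
  SimpleGraph.fromRel (fun i j => ((i : ℕ), (j : ℕ)) ∈ [(0,1),(1,2),(0,2),(0,3),(1,4)])

/-- The butterfly: triangles `0 1 2` and `2 3 4` sharing the vertex `2`. -/
def butterfly : SimpleGraph (Fin 5) :=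
  SimpleGraph.fromRel (fun i j =>
    ((i : ℕ), (j : ℕ)) ∈ [(0,1),(1,2),(0,2),(2,3),(3,4),(2,4)])

/-- The gem: a path `0 1 2 3` plus the vertex `4` adjacent to all path vertices. -/
def gem : SimpleGraph (Fin 5) :=
  SimpleGraph.fromRel (fun i j =>
    ((i : ℕ), (j : ℕ)) ∈ [(0,1),(1,2),(2,3),(4,0),(4,1),(4,2),(4,3)])

/-- Some `f : Fin 5 → ℕ` with values in `S` satisfies `r (f i) (f j) b` for each pair `i < j`
with associated bit `b`; the pairs are taken in the order `01, 02, 12, 03, 13, 23, 04, 14, 24, 34`.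
The nesting of the quantifiers makes the evident decision procedure a backtracking search. -/
def HasLabelling (S : List ℕ) (r : ℕ → ℕ → Bool → Bool)
    (b01 b02 b12 b03 b13 b23 b04 b14 b24 b34 : Bool) : Bool :=
  S.any fun x₀ => S.any fun x₁ => r x₀ x₁ b01 &&
  S.any fun x₂ => r x₀ x₂ b02 && (r x₁ x₂ b12 &&
  S.any fun x₃ => r x₀ x₃ b03 && (r x₁ x₃ b13 && (r x₂ x₃ b23 &&
  S.any fun x₄ => r x₀ x₄ b04 && (r x₁ x₄ b14 && (r x₂ x₄ b24 && r x₃ x₄ b34)))))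

/-- The sum of the labels `x`, `y` lies in `[12, 16]` exactly if the bit is set. -/
def weightRel (x y : ℕ) (b : Bool) : Bool :=
  cond b (Nat.ble 12 (Nat.add x y) && Nat.ble (Nat.add x y) 16)
    (Nat.blt (Nat.add x y) 12 || Nat.blt 16 (Nat.add x y))

/-- Distinct labels `x`, `y` form a pair in the list `E`, in one of the two orders, exactly if
the bit is set. -/
def edgeRel (E : List (ℕ × ℕ)) (x y : ℕ) (b : Bool) : Bool :=
  !(Nat.beq x y) &&
    (E.any (fun p => (Nat.beq p.1 x && Nat.beq p.2 y) || (Nat.beq p.1 y && Nat.beq p.2 x)) == b)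

/-- The degrees in the graph on `Fin 5` encoded by the ten bits are non-decreasing. -/
def DegreesMonotone (b01 b02 b12 b03 b13 b23 b04 b14 b24 b34 : Bool) : Bool :=
  Nat.ble (b01.toNat + b02.toNat + b03.toNat + b04.toNat)
    (b01.toNat + b12.toNat + b13.toNat + b14.toNat) &&
  (Nat.ble (b01.toNat + b12.toNat + b13.toNat + b14.toNat)
    (b02.toNat + b12.toNat + b23.toNat + b24.toNat) &&
  (Nat.ble (b02.toNat + b12.toNat + b23.toNat + b24.toNat)
    (b03.toNat + b13.toNat + b23.toNat + b34.toNat) &&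
  Nat.ble (b03.toNat + b13.toNat + b23.toNat + b34.toNat)
    (b04.toNat + b14.toNat + b24.toNat + b34.toNat)))

theorem hasLabelling_weight_or_edge :
    ∀ b01 b02 b12 b03 b13 b23 b04 b14 b24 b34 : Bool,
      (!DegreesMonotone b01 b02 b12 b03 b13 b23 b04 b14 b24 b34 ||
      (HasLabelling [7, 3, 6, 5, 11, 0, 9] weightRel b01 b02 b12 b03 b13 b23 b04 b14 b24 b34 ||
      (HasLabelling [0, 1, 2, 3, 4] (edgeRel [(0,1),(1,2),(2,3),(3,4),(4,0)])
        b01 b02 b12 b03 b13 b23 b04 b14 b24 b34 ||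
      (HasLabelling [0, 1, 2, 3, 4] (edgeRel [(0,1),(1,2),(0,2),(0,3),(1,4)])
        b01 b02 b12 b03 b13 b23 b04 b14 b24 b34 ||
      (HasLabelling [0, 1, 2, 3, 4] (edgeRel [(0,1),(1,2),(0,2),(2,3),(3,4),(2,4)])
        b01 b02 b12 b03 b13 b23 b04 b14 b24 b34 ||
      HasLabelling [0, 1, 2, 3, 4] (edgeRel [(0,1),(1,2),(2,3),(4,0),(4,1),(4,2),(4,3)])
        b01 b02 b12 b03 b13 b23 b04 b14 b24 b34))))) = true := by
  decide +kernel

theorem HasLabelling.exists_fun {S : List ℕ} {r : ℕ → ℕ → Bool → Bool} {a : Fin 5 → Fin 5 → Bool}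
    (h : HasLabelling S r (a 0 1) (a 0 2) (a 1 2) (a 0 3) (a 1 3) (a 2 3) (a 0 4) (a 1 4) (a 2 4)
      (a 3 4) = true) :
    ∃ f : Fin 5 → ℕ, (∀ i, f i ∈ S) ∧ ∀ i j, i < j → r (f i) (f j) (a i j) = true := by
  simp only [HasLabelling, List.any_eq_true, Bool.and_eq_true] at h
  obtain ⟨x₀, h₀, x₁, h₁, h01, x₂, h₂, h02, h12, x₃, h₃, h03, h13, h23, x₄, h₄, h04, h14, h24,
    h34⟩ := h
  refine ⟨![x₀, x₁, x₂, x₃, x₄], ?_, ?_⟩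
  · intro i
    fin_cases i <;> assumption
  · intro i j hij
    fin_cases i <;> fin_cases j <;> first | assumption | exact absurd hij (by decide)

theorem isDoubleThreshold_of_hasLabelling {G : SimpleGraph (Fin 5)} {a : Fin 5 → Fin 5 → Bool}
    (ha : ∀ i j, G.Adj i j ↔ a i j = true) {S : List ℕ}
    (h : HasLabelling S weightRel (a 0 1) (a 0 2) (a 1 2) (a 0 3) (a 1 3) (a 2 3) (a 0 4) (a 1 4)
      (a 2 4) (a 3 4) = true) : IsDoubleThreshold G := by
  obtain ⟨f, -, hf⟩ := HasLabelling.exists_fun h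
  have key : ∀ i j, i < j → (G.Adj i j ↔ (12 : ℝ) ≤ f i + f j ∧ (f i + f j : ℝ) ≤ 16) := by
    intro i j hij
    have := hf i j hij
    rw [ha]
    norm_cast
    cases hb : a i j <;>
      simp only [weightRel, hb, cond_true, cond_false, Bool.and_eq_true, Bool.or_eq_true,
        Nat.ble_eq, Nat.blt_eq, Nat.add_eq] at this <;> grind
  refine ⟨fun i => f i, 12, 16, fun i j hij => ?_⟩
  rcases lt_or_gt_of_ne hij with hij | hij
  · exact key i j hij
  · rw [G.adj_comm, key j i hij, add_comm]

theorem nonempty_iso_of_hasLabelling {G : SimpleGraph (Fin 5)} {a : Fin 5 → Fin 5 → Bool}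
    (ha : ∀ i j, G.Adj i j ↔ a i j = true) {E : List (ℕ × ℕ)}
    (h : HasLabelling [0, 1, 2, 3, 4] (edgeRel E) (a 0 1) (a 0 2) (a 1 2) (a 0 3) (a 1 3) (a 2 3)
      (a 0 4) (a 1 4) (a 2 4) (a 3 4) = true) :
    Nonempty (G ≃g SimpleGraph.fromRel (fun i j : Fin 5 => ((i : ℕ), (j : ℕ)) ∈ E)) := by
  obtain ⟨f, hS, hf⟩ := HasLabelling.exists_fun h
  have hlt : ∀ i, f i < 5 := fun i => by
    have := hS i
    simp only [List.mem_cons, List.not_mem_nil, or_false] at this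
    omega
  set H := SimpleGraph.fromRel (fun i j : Fin 5 => ((i : ℕ), (j : ℕ)) ∈ E) with hH
  let g : Fin 5 → Fin 5 := fun i => ⟨f i, hlt i⟩
  have key : ∀ i j, i < j → g i ≠ g j ∧ (H.Adj (g i) (g j) ↔ G.Adj i j) := by
    intro i j hij
    have := hf i j hij
    simp only [edgeRel, Bool.and_eq_true, Bool.not_eq_true', beq_iff_eq] at this
    have hne : g i ≠ g j := fun hg => by
      simp [Fin.mk.inj_iff.mp hg] at this
    refine ⟨hne, ?_⟩
    rw [ha, ← this.2, hH, SimpleGraph.fromRel_adj]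
    simp only [hne, ne_eq, not_false_eq_true, true_and, List.any_eq_true, Bool.or_eq_true,
      Bool.and_eq_true, Nat.beq_eq, g]
    constructor
    · rintro (hm | hm)
      exacts [⟨_, hm, .inl ⟨rfl, rfl⟩⟩, ⟨_, hm, .inr ⟨rfl, rfl⟩⟩]
    · rintro ⟨⟨x, y⟩, hm, ⟨rfl, rfl⟩ | ⟨rfl, rfl⟩⟩
      exacts [.inl hm, .inr hm]
  have hinj : Function.Injective g := fun i j hg => by
    rcases lt_trichotomy i j with hij | hij | hij
    exacts [absurd hg (key i j hij).1, hij, absurd hg.symm (key j i hij).1]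
  refine ⟨⟨Equiv.ofBijective g hinj.bijective_of_finite, fun {i j} => ?_⟩⟩
  rcases lt_trichotomy i j with hij | rfl | hij
  · exact (key i j hij).2
  · simp
  · rw [H.adj_comm, G.adj_comm]
    exact (key j i hij).2

theorem IsDoubleThreshold.comap {V W : Type*} {G : SimpleGraph V} {H : SimpleGraph W}
    (hH : IsDoubleThreshold H) (f : G ↪g H) : IsDoubleThreshold G := by
  obtain ⟨w, lb, ub, h⟩ := hH
  refine ⟨w ∘ f, lb, ub, fun u v huv => ?_⟩
  rw [← f.map_adj_iff]
  exact h _ _ (f.injective.ne huv)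

theorem exists_perm_monotone_degree (G : SimpleGraph (Fin 5)) [DecidableRel G.Adj] :
    ∃ σ : Equiv.Perm (Fin 5), Monotone fun i => ∑ j, (decide (G.Adj (σ i) (σ j))).toNat := by
  let d : Fin 5 → ℕ := fun i => ∑ j, (decide (G.Adj i j)).toNat
  refine ⟨Tuple.sort d, ?_⟩
  have h : (fun i => ∑ j, (decide (G.Adj (Tuple.sort d i) (Tuple.sort d j))).toNat) =
      d ∘ Tuple.sort d :=
    funext fun i => Equiv.sum_comp (Tuple.sort d) fun j => (decide (G.Adj (Tuple.sort d i) j)).toNat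
  exact h ▸ Tuple.monotone_sort d

theorem isDoubleThreshold_or_iso_fin_five (G : SimpleGraph (Fin 5)) :
    IsDoubleThreshold G ∨ Nonempty (G ≃g cycle5) ∨ Nonempty (G ≃g bull) ∨
      Nonempty (G ≃g butterfly) ∨ Nonempty (G ≃g gem) := by
  classical
  obtain ⟨σ, hσ⟩ := exists_perm_monotone_degree G
  let e : G.comap σ ≃g G := SimpleGraph.Iso.comap σ G
  let a : Fin 5 → Fin 5 → Bool := fun i j => decide (G.Adj (σ i) (σ j))
  have ha : ∀ i j, (G.comap σ).Adj i j ↔ a i j = true := fun i j => (decide_eq_true_iff).symm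
  have hloop : ∀ i, a i i = false := fun i => by simp [a]
  have hsymm : ∀ i j, a i j = a j i := fun i j => by simp only [a, G.adj_comm]
  have hmono : DegreesMonotone (a 0 1) (a 0 2) (a 1 2) (a 0 3) (a 1 3) (a 2 3) (a 0 4)
      (a 1 4) (a 2 4) (a 3 4) = true := by
    change Monotone fun i => ∑ j, (a i j).toNat at hσ
    have h01 := hσ (show (0 : Fin 5) ≤ 1 by decide)
    have h12 := hσ (show (1 : Fin 5) ≤ 2 by decide)
    have h23 := hσ (show (2 : Fin 5) ≤ 3 by decide)
    have h34 := hσ (show (3 : Fin 5) ≤ 4 by decide)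
    simp only [Fin.sum_univ_five, hloop, Bool.toNat_false, zero_add, add_zero, hsymm 1 0,
      hsymm 2 0, hsymm 2 1, hsymm 3 0, hsymm 3 1, hsymm 3 2, hsymm 4 0, hsymm 4 1, hsymm 4 2,
      hsymm 4 3] at h01 h12 h23 h34
    simp only [DegreesMonotone, Bool.and_eq_true, Nat.ble_eq]
    exact ⟨h01, h12, h23, h34⟩
  have h := hasLabelling_weight_or_edge (a 0 1) (a 0 2) (a 1 2) (a 0 3) (a 1 3) (a 2 3) (a 0 4)
    (a 1 4) (a 2 4) (a 3 4)
  simp only [hmono, Bool.not_true, Bool.false_or, Bool.or_eq_true] at h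
  have transfer {H : SimpleGraph (Fin 5)} : Nonempty (G.comap σ ≃g H) → Nonempty (G ≃g H) :=
    fun ⟨g⟩ => ⟨e.symm.trans g⟩
  exact h.imp (fun h => (isDoubleThreshold_of_hasLabelling ha h).comap e.symm.toEmbedding) <|
    Or.imp (transfer ∘ nonempty_iso_of_hasLabelling ha) <|
    Or.imp (transfer ∘ nonempty_iso_of_hasLabelling ha) <|
    Or.imp (transfer ∘ nonempty_iso_of_hasLabelling ha)
      (transfer ∘ nonempty_iso_of_hasLabelling ha)

/-- A graph on `V` extended by isolated vertices along `f : V ↪ W`, if isomorphic to a graph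
without isolated vertices, has not been extended at all. -/
theorem nonempty_iso_of_map_iso {V W X : Type*} {G : SimpleGraph V} {H : SimpleGraph X}
    (f : V ↪ W) (hH : ∀ x, ∃ y, H.Adj x y) (h : Nonempty (G.map f ≃g H)) :
    Nonempty (G ≃g H) := by
  obtain ⟨e⟩ := h
  have hsurj : Function.Surjective f := fun w => by
    obtain ⟨y, hy⟩ := hH (e w)
    have hadj : (G.map f).Adj w (e.symm y) := by
      rw [← e.map_adj_iff, e.apply_symm_apply]
      exact hy
    rw [SimpleGraph.map_adj] at hadj
    obtain ⟨u, -, -, hu, -⟩ := hadj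
    exact ⟨u, hu⟩
  let g : G ≃g G.map f :=
    ⟨Equiv.ofBijective f ⟨f.injective, hsurj⟩, fun {i j} => SimpleGraph.map_adj_apply⟩
  exact ⟨g.trans e⟩

theorem not_isDoubleThreshold_cycle5 : ¬ IsDoubleThreshold cycle5 := by
  rintro ⟨w, lb, ub, h⟩
  simp [DefinesDTG, Fin.forall_fin_succ, cycle5] at h
  grind

theorem not_isDoubleThreshold_bull : ¬ IsDoubleThreshold bull := by
  rintro ⟨w, lb, ub, h⟩
  simp [DefinesDTG, Fin.forall_fin_succ, bull] at h
  grind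

theorem not_isDoubleThreshold_butterfly : ¬ IsDoubleThreshold butterfly := by
  rintro ⟨w, lb, ub, h⟩
  simp [DefinesDTG, Fin.forall_fin_succ, butterfly] at h
  grind

theorem not_isDoubleThreshold_gem : ¬ IsDoubleThreshold gem := by
  rintro ⟨w, lb, ub, h⟩
  simp [DefinesDTG, Fin.forall_fin_succ, gem] at h
  grind

/-- A graph with at most five vertices is not a double-threshold graph iff it is
isomorphic to the 5-cycle, the bull, the butterfly, or the gem. -/
theorem non_dtg_order_le_five_iff {V : Type*} [Fintype V] (G : SimpleGraph V)
    (hcard : Fintype.card V ≤ 5) :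
    ¬ IsDoubleThreshold G ↔
      (Nonempty (G ≃g cycle5) ∨ Nonempty (G ≃g bull) ∨
        Nonempty (G ≃g butterfly) ∨ Nonempty (G ≃g gem)) := by
  constructor
  · intro hG
    obtain ⟨f⟩ : Nonempty (V ↪ Fin 5) :=
      Function.Embedding.nonempty_of_card_le (by simpa using hcard)
    rcases isDoubleThreshold_or_iso_fin_five (G.map f) with h | h
    · exact absurd (h.comap (SimpleGraph.Embedding.map f G)) hG
    · refine h.imp (nonempty_iso_of_map_iso f ?_) <|
        Or.imp (nonempty_iso_of_map_iso f ?_) <|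
        Or.imp (nonempty_iso_of_map_iso f ?_) (nonempty_iso_of_map_iso f ?_)
      · simp only [cycle5, SimpleGraph.fromRel_adj]
        decide
      · simp only [bull, SimpleGraph.fromRel_adj]
        decide
      · simp only [butterfly, SimpleGraph.fromRel_adj]
        decide
      · simp only [gem, SimpleGraph.fromRel_adj]
        decide
  · rintro (⟨⟨e⟩⟩ | ⟨⟨e⟩⟩ | ⟨⟨e⟩⟩ | ⟨⟨e⟩⟩) hG
    · exact not_isDoubleThreshold_cycle5 (hG.comap e.symm.toEmbedding)
    · exact not_isDoubleThreshold_bull (hG.comap e.symm.toEmbedding)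
    · exact not_isDoubleThreshold_butterfly (hG.comap e.symm.toEmbedding)
    · exact not_isDoubleThreshold_gem (hG.comap e.symm.toEmbedding)
end

section
/- The graph 2K₃ (the disjoint union of two triangles) is the unique disconnected minimal forbidden induced subgraph for the class of double-threshold graphs. That is: (i) 2K₃ is not a double-threshold graph, while every proper induced subgraph of 2K₃ is a double-threshold graph; and (ii) if G is any disconnected finite simple graph that is not a double-threshold graph but all of whose proper induced subgraphs are double-threshold graphs, then G is isomorphic to 2K₃. -/
/-- `2K₃`: the disjoint union of two triangles, on vertices `{0,1,2}` and `{3,4,5}`. -/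
def twoK3 : SimpleGraph (Fin 6) :=
  SimpleGraph.fromRel (fun i j => (i : ℕ) / 3 = (j : ℕ) / 3)

/-- A graph is disconnected if it has at least two connected components. -/
def IsDisconnected {V : Type*} (G : SimpleGraph V) : Prop :=
  ∃ c c' : G.ConnectedComponent, c ≠ c'

namespace IsDoubleThreshold

variable {V W : Type*} {G : SimpleGraph V}

theorem of_embedding {H : SimpleGraph W} (f : H ↪g G) (hG : IsDoubleThreshold G) :
    IsDoubleThreshold H := by
  obtain ⟨w, lb, ub, h⟩ := hG
  refine ⟨w ∘ f, lb, ub, fun u v huv => ?_⟩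
  rw [← f.map_adj_iff]
  exact h _ _ (f.injective.ne huv)

/-- On a finite vertex set the thresholds can be taken to be `-1` and `1`. -/
theorem exists_weight_abs_le_one [Finite V] (hG : IsDoubleThreshold G) :
    ∃ w : V → ℝ, ∀ u v, u ≠ v → (G.Adj u v ↔ |w u + w v| ≤ 1) := by
  obtain ⟨w, lb, ub, h⟩ := hG
  rcases lt_or_ge ub lb with hlt | hle
  · refine ⟨fun _ => 1, fun u v huv => ?_⟩
    rw [h u v huv]
    norm_num
    intro h1
    linarith
  · set t : ℝ := (ub - lb) / 2 with ht
    set x : V → ℝ := fun v => w v - (lb + ub) / 4 with hx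
    have hadj : ∀ u v, u ≠ v → (G.Adj u v ↔ |x u + x v| ≤ t) := by
      intro u v huv
      rw [h u v huv, abs_le]
      simp only [hx, ht]
      constructor <;> rintro ⟨h1, h2⟩ <;> constructor <;> linarith
    have ht0 : 0 ≤ t := by simp only [ht]; linarith
    -- enlarge the threshold slightly to make it positive
    obtain ⟨s, hts, hs⟩ : ∃ s, t < s ∧ ∀ p : V × V, t < |x p.1 + x p.2| → s < |x p.1 + x p.2| := by
      have hev : ∀ᶠ s in nhdsWithin t (Set.Ioi t),
          ∀ p : V × V, t < |x p.1 + x p.2| → s < |x p.1 + x p.2| := by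
        rw [Filter.eventually_all]
        intro p
        by_cases hp : t < |x p.1 + x p.2|
        · filter_upwards [Ioo_mem_nhdsGT hp] with s hs _ using hs.2
        · simp [hp]
      obtain ⟨s, hs, hs'⟩ := (hev.and self_mem_nhdsWithin).exists
      exact ⟨s, hs', hs⟩
    have hs0 : 0 < s := ht0.trans_lt hts
    refine ⟨fun v => x v / s, fun u v huv => ?_⟩
    rw [hadj u v huv, ← add_div, abs_div, abs_of_pos hs0, div_le_one hs0]
    exact ⟨fun h1 => h1.trans hts.le, fun h1 => not_lt.1 fun h2 => (hs (u, v) h2).not_ge h1⟩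

/-- A finite triangle-free double-threshold graph is bipartite. -/
theorem colorable_two [Finite V] (hG : IsDoubleThreshold G) (hfree : G.CliqueFree 3) :
    G.Colorable 2 := by
  classical
  obtain ⟨w, lb, ub, h⟩ := hG
  obtain ⟨n, ⟨e⟩⟩ := Finite.exists_equiv_fin V
  let key : V → ℝ ×ₗ Fin n := fun v => toLex (w v, e v)
  have key_inj : Function.Injective key := fun u v huv => by
    have h1 := congrArg (fun z => (ofLex z).2) huv
    exact e.injective h1
  have key_le : ∀ u v, key u < key v → w u ≤ w v := by
    intro u v huv
    rcases Prod.Lex.toLex_lt_toLex.1 huv with h1 | h1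
    · exact h1.le
    · exact h1.1.le
  -- the ends of a monotone path on three vertices are adjacent
  have no_path : ∀ u v x, key u < key v → key v < key x → G.Adj u v → ¬ G.Adj v x := by
    intro u v x huv hvx h1 h2
    have hne : u ≠ x := fun hh => (huv.trans hvx).ne (congrArg key hh)
    have h3 : G.Adj u x := by
      have b1 := (h u v h1.ne).1 h1
      have b2 := (h v x h2.ne).1 h2
      have c1 := key_le _ _ huv
      have c2 := key_le _ _ hvx
      exact (h u x hne).2 ⟨by linarith, by linarith⟩
    exact hfree {u, v, x} (SimpleGraph.is3Clique_triple_iff.2 ⟨h1, h3, h2⟩)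
  let c : V → Bool := fun v => decide (∃ u, G.Adj u v ∧ key u < key v)
  have aux : ∀ u v, G.Adj u v → key u < key v → c u ≠ c v := by
    intro u v huv hlt
    have hv : c v = true := decide_eq_true ⟨u, huv, hlt⟩
    have hu : c u = false := by
      refine decide_eq_false ?_
      rintro ⟨x, hx, hxu⟩
      exact no_path x u v hxu hlt hx huv
    rw [hu, hv]
    decide
  have hc : ∀ {u v}, G.Adj u v → c u ≠ c v := by
    intro u v huv
    rcases lt_or_gt_of_ne (key_inj.ne huv.ne) with hlt | hlt
    · exact aux u v huv hlt
    · exact (aux v u huv.symm hlt).symm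
  exact (SimpleGraph.Coloring.mk c hc).colorable

/-- A bipartite union of components can be glued to the rest of the graph. -/
theorem of_induce_compl [Finite V] {A : Set V} (hcut : ∀ u ∈ A, ∀ v ∉ A, ¬ G.Adj u v)
    (hA : IsDoubleThreshold (G.induce A)) (hcol : (G.induce A).Colorable 2)
    (hB : IsDoubleThreshold (G.induce Aᶜ)) : IsDoubleThreshold G := by
  classical
  obtain ⟨a, ha⟩ := hA.exists_weight_abs_le_one
  obtain ⟨b, hb⟩ := hB.exists_weight_abs_le_one
  obtain ⟨χ⟩ := hcol
  obtain ⟨C, hC⟩ := (Set.finite_range fun v => |a v|).bddAbove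
  obtain ⟨D, hD⟩ := (Set.finite_range fun v => |b v|).bddAbove
  have hC' : ∀ v, -C ≤ a v ∧ a v ≤ C := fun v => abs_le.1 (hC ⟨v, rfl⟩)
  have hD' : ∀ v, -D ≤ b v ∧ b v ≤ D := fun v => abs_le.1 (hD ⟨v, rfl⟩)
  let M : ℝ := |C| + |D| + 2
  let w : V → ℝ := fun v =>
    if h : v ∈ A then a ⟨v, h⟩ + (if χ ⟨v, h⟩ = 0 then M else -M) else b ⟨v, h⟩
  have hMC := le_abs_self C
  have hMD := le_abs_self D
  have hC0 := abs_nonneg C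
  have hD0 := abs_nonneg D
  have cross : ∀ u ∈ A, ∀ v ∉ A, ¬ (-1 ≤ w u + w v ∧ w u + w v ≤ 1) := by
    rintro u hu v hv ⟨h1, h2⟩
    have b1 := hC' ⟨u, hu⟩
    have b2 := hD' ⟨v, hv⟩
    simp only [w, hu, hv, dite_true, dite_false, M] at h1 h2
    split_ifs at h1 h2 <;> linarith
  refine ⟨w, -1, 1, fun u v huv => ?_⟩
  by_cases hu : u ∈ A <;> by_cases hv : v ∈ A
  · have key := ha ⟨u, hu⟩ ⟨v, hv⟩ (by simpa using huv)
    have col := fun h => χ.valid (v := ⟨u, hu⟩) (w := ⟨v, hv⟩) h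
    have b1 := hC' ⟨u, hu⟩
    have b2 := hC' ⟨v, hv⟩
    change G.Adj u v → _ at col
    change G.Adj u v ↔ _ at key
    simp only [w, hu, hv, dite_true]
    by_cases c1 : χ ⟨u, hu⟩ = 0 <;> by_cases c2 : χ ⟨v, hv⟩ = 0
    · refine ⟨fun h => absurd (c1.trans c2.symm) (col h), fun h => ?_⟩
      simp only [c1, c2, if_true, M] at h
      linarith
    · rw [key, abs_le]
      simp only [c1, c2, if_true, if_false]
      ring_nf
    · rw [key, abs_le]
      simp only [c1, c2, if_true, if_false]
      ring_nf
    · refine ⟨fun h => absurd (by omega) (col h), fun h => ?_⟩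
      simp only [c1, c2, if_false, M] at h
      linarith
  · exact iff_of_false (hcut u hu v hv) (cross u hu v hv)
  · rw [G.adj_comm, add_comm]
    exact iff_of_false (hcut v hv u hu) (cross v hv u hu)
  · have key := hb ⟨u, hu⟩ ⟨v, hv⟩ (by simpa using huv)
    change G.Adj u v ↔ _ at key
    simp only [w, hu, hv, dite_false]
    rw [key, abs_le]

end IsDoubleThreshold

theorem twoK3_adj {i j : Fin 6} : twoK3.Adj i j ↔ i ≠ j ∧ (i : ℕ) / 3 = (j : ℕ) / 3 := by
  simp [twoK3, SimpleGraph.fromRel_adj, eq_comm]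

/-- The median of three numbers with all pairwise sums in `[lb, ub]` has its double there. -/
theorem exists_two_mul_mem_of_pairwise_add_mem {ι : Type*} (w : ι → ℝ) {lb ub : ℝ} (i j k : ι)
    (hij : lb ≤ w i + w j ∧ w i + w j ≤ ub) (hik : lb ≤ w i + w k ∧ w i + w k ≤ ub)
    (hjk : lb ≤ w j + w k ∧ w j + w k ≤ ub) :
    ∃ m, (m = i ∨ m = j ∨ m = k) ∧ lb ≤ 2 * w m ∧ 2 * w m ≤ ub := by
  rcases le_total (w i) (w j) with h1 | h1 <;> rcases le_total (w j) (w k) with h2 | h2 <;>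
    rcases le_total (w i) (w k) with h3 | h3
  all_goals
    first
    | exact ⟨i, by simp, by linarith, by linarith⟩
    | exact ⟨j, by simp, by linarith, by linarith⟩
    | exact ⟨k, by simp, by linarith, by linarith⟩

theorem not_isDoubleThreshold_twoK3 : ¬ IsDoubleThreshold twoK3 := by
  rintro ⟨w, lb, ub, h⟩
  have adj : ∀ i j : Fin 6, i ≠ j → (i : ℕ) / 3 = (j : ℕ) / 3 →
      lb ≤ w i + w j ∧ w i + w j ≤ ub :=
    fun i j hne hij => (h i j hne).1 (twoK3_adj.2 ⟨hne, hij⟩)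
  obtain ⟨p, hp, hp1, hp2⟩ := exists_two_mul_mem_of_pairwise_add_mem w 0 1 2
    (adj _ _ (by decide) (by decide)) (adj _ _ (by decide) (by decide))
    (adj _ _ (by decide) (by decide))
  obtain ⟨q, hq, hq1, hq2⟩ := exists_two_mul_mem_of_pairwise_add_mem w 3 4 5
    (adj _ _ (by decide) (by decide)) (adj _ _ (by decide) (by decide))
    (adj _ _ (by decide) (by decide))
  have hpq : p ≠ q ∧ (p : ℕ) / 3 ≠ (q : ℕ) / 3 := by
    rcases hp with rfl | rfl | rfl <;> rcases hq with rfl | rfl | rfl <;> decide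
  exact hpq.2 (twoK3_adj.1 ((h p q hpq.1).2 ⟨by linarith, by linarith⟩)).2

/-- Integer weights, with thresholds `-1` and `1`, representing `2K₃` with the vertex `k` deleted. -/
def twoK3Weight (k i : Fin 6) : ℤ :=
  if (i : ℕ) / 3 = (k : ℕ) / 3 then (if (i : ℕ) % 3 = ((k : ℕ) + 1) % 3 then 5 else -5) else 0

theorem twoK3Weight_spec : ∀ k i j : Fin 6, i ≠ k → j ≠ k → i ≠ j →
    ((i : ℕ) / 3 = (j : ℕ) / 3 ↔
      -1 ≤ twoK3Weight k i + twoK3Weight k j ∧ twoK3Weight k i + twoK3Weight k j ≤ 1) := by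
  decide

theorem isDoubleThreshold_induce_twoK3 {S : Set (Fin 6)} (hS : S ≠ Set.univ) :
    IsDoubleThreshold (twoK3.induce S) := by
  obtain ⟨k, hk⟩ := (Set.ne_univ_iff_exists_notMem S).1 hS
  refine ⟨fun i => twoK3Weight k i, -1, 1, fun i j hij => ?_⟩
  change twoK3.Adj i j ↔ _
  have hne := Subtype.coe_injective.ne hij
  rw [twoK3_adj, and_iff_right hne, twoK3Weight_spec k i j (fun h => hk (h ▸ i.2))
    (fun h => hk (h ▸ j.2)) hne, ← @Int.cast_le ℝ, ← @Int.cast_le ℝ]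
  push_cast
  rfl

/-- Two triangles with no edges between them span a copy of `2K₃`. -/
theorem nonempty_twoK3_embedding {V : Type*} {G : SimpleGraph V} {A : Set V}
    (hcut : ∀ u ∈ A, ∀ v ∉ A, ¬ G.Adj u v) (hA : ¬ (G.induce A).CliqueFree 3)
    (hB : ¬ (G.induce Aᶜ).CliqueFree 3) : Nonempty (twoK3 ↪g G) := by
  classical
  simp only [SimpleGraph.CliqueFree, not_forall, not_not, SimpleGraph.is3Clique_iff] at hA hB
  obtain ⟨-, a, b, c, hab, hac, hbc, -⟩ := hA
  obtain ⟨-, x, y, z, hxy, hxz, hyz, -⟩ := hB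
  change G.Adj a b at hab
  change G.Adj a c at hac
  change G.Adj b c at hbc
  change G.Adj x y at hxy
  change G.Adj x z at hxz
  change G.Adj y z at hyz
  let f : Fin 6 → V := ![a, b, c, x, y, z]
  have hlow : ∀ i : Fin 6, (i : ℕ) / 3 = 0 → f i ∈ A := by
    intro i hi
    fin_cases i <;> first | exact a.2 | exact b.2 | exact c.2 | simp at hi
  have hhigh : ∀ i : Fin 6, (i : ℕ) / 3 ≠ 0 → f i ∉ A := by
    intro i hi
    fin_cases i <;> first | exact x.2 | exact y.2 | exact z.2 | simp at hi
  have hsame : ∀ i j : Fin 6, i ≠ j → (i : ℕ) / 3 = (j : ℕ) / 3 → G.Adj (f i) (f j) := by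
    intro i j hne hij
    fin_cases i <;> fin_cases j <;>
      first
      | exact absurd rfl hne
      | exact absurd hij (by decide)
      | assumption
      | exact SimpleGraph.Adj.symm (by assumption)
  have hdiff : ∀ i j : Fin 6, (i : ℕ) / 3 ≠ (j : ℕ) / 3 → f i ≠ f j ∧ ¬ G.Adj (f i) (f j) := by
    intro i j hij
    by_cases hi : (i : ℕ) / 3 = 0
    · have hj := hhigh j (by omega)
      exact ⟨fun h => hj (h ▸ hlow i hi), hcut _ (hlow i hi) _ hj⟩
    · have hj := hlow j (by omega)
      exact ⟨fun h => hhigh i hi (h ▸ hj), fun h => hcut _ hj _ (hhigh i hi) h.symm⟩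
  have hinj : Function.Injective f := by
    intro i j hij
    by_contra hne
    by_cases h : (i : ℕ) / 3 = (j : ℕ) / 3
    · exact (hsame i j hne h).ne hij
    · exact (hdiff i j h).1 hij
  refine ⟨⟨⟨f, hinj⟩, ?_⟩⟩
  intro i j
  change G.Adj (f i) (f j) ↔ _
  rw [twoK3_adj]
  refine ⟨fun h => ⟨fun hij => h.ne (congrArg f hij), ?_⟩, fun h => hsame i j h.1 h.2⟩
  by_contra hij
  exact (hdiff i j hij).2 h

/-- `2K₃` is the unique disconnected minimal forbidden induced subgraph for
double-threshold graphs: it is not a double-threshold graph, every proper induced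
subgraph of it is, and any disconnected graph with these two properties is
isomorphic to `2K₃`. -/
theorem twoK3_unique_disconnected_minimal_forbidden :
    (¬ IsDoubleThreshold twoK3 ∧
      ∀ S : Set (Fin 6), S ≠ Set.univ → IsDoubleThreshold (SimpleGraph.induce S twoK3)) ∧
    ∀ (V : Type*) [Fintype V] (G : SimpleGraph V), IsDisconnected G →
      ¬ IsDoubleThreshold G →
      (∀ S : Set V, S ≠ Set.univ → IsDoubleThreshold (SimpleGraph.induce S G)) →
      Nonempty (G ≃g twoK3) := by
  refine ⟨⟨not_isDoubleThreshold_twoK3, fun S hS => isDoubleThreshold_induce_twoK3 hS⟩, ?_⟩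
  intro V _ G ⟨c, c', hcc⟩ hG hmin
  have hcut : ∀ u ∈ c.supp, ∀ v ∉ c.supp, ¬ G.Adj u v := fun u hu v hv huv =>
    hv ((c.mem_supp_congr_adj huv).1 hu)
  have hcut' : ∀ u ∈ c.suppᶜ, ∀ v ∉ c.suppᶜ, ¬ G.Adj u v := fun u hu v hv huv =>
    hcut v (not_not.1 hv) u hu huv.symm
  obtain ⟨a, ha⟩ := c.nonempty_supp
  obtain ⟨b, hb⟩ := c'.nonempty_supp
  have hA := hmin c.supp ((Set.ne_univ_iff_exists_notMem _).2 ⟨b, fun h => hcc (h.symm.trans hb)⟩)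
  have hB := hmin c.suppᶜ ((Set.ne_univ_iff_exists_notMem _).2 ⟨a, fun h => h ha⟩)
  obtain ⟨f⟩ := nonempty_twoK3_embedding hcut
    (fun h => hG (.of_induce_compl hcut hA (hA.colorable_two h) hB))
    (fun h => hG (.of_induce_compl hcut' hB (hB.colorable_two h) (by rwa [compl_compl])))
  have hsurj : Function.Surjective f := by
    rw [← Set.range_eq_univ]
    by_contra hne
    refine not_isDoubleThreshold_twoK3 ((hmin _ hne).of_embedding
      ⟨⟨fun i => ⟨f i, i, rfl⟩, fun i j hij => f.injective (congrArg Subtype.val hij)⟩, ?_⟩)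
    exact f.map_adj_iff
  exact ⟨(RelIso.ofSurjective f hsurj).symm⟩
end
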